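/- arXiv:2202.07095 — 3 statements merged into one kernel-verified Lean document; each statement's English description precedes it below -/
import Mathlib

section
/- If P has finite length as an L-module, then the L-submodule P^W of W-invariant elements of P also has finite length as an L-module, and length_L(P) = |W| · length_L(P^W). -/
/-- A free action admits a transversal: a set meeting every orbit, through a unique group
element. -/
theorem MulAction.exists_transversal_of_free {W X : Type*} [Group W] [MulAction W X]
    (hfree : ∀ (w : W) (c : X), w • c = c → w = 1) :
    ∃ T : Set X, ∀ c : X, ∃! w : W, w⁻¹ • c ∈ T := by
  refine ⟨Set.range (Quotient.out : MulAction.orbitRel.Quotient W X → X), fun c => ?_⟩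
  have hout : ∀ v : W, v⁻¹ • c ∈ Set.range (Quotient.out : MulAction.orbitRel.Quotient W X → X) →
      (Quotient.out (Quotient.mk (MulAction.orbitRel W X) c)) = v⁻¹ • c := by
    rintro v ⟨q, hq⟩
    have hqc : q = Quotient.mk (MulAction.orbitRel W X) c := by
      rw [← Quotient.out_eq q, hq]
      exact Quotient.sound (MulAction.orbitRel_apply.mpr ⟨v⁻¹, rfl⟩)
    rw [← hqc, hq]
  obtain ⟨g, hg⟩ := MulAction.orbitRel_apply.mp
    (Quotient.exact (Quotient.out_eq (Quotient.mk (MulAction.orbitRel W X) c)))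
  refine ⟨g⁻¹, ⟨_, by simpa using hg.symm⟩, fun v hv => ?_⟩
  have hvg : v⁻¹ • c = g • c := (hout v hv).symm.trans hg.symm
  have hone : g⁻¹ * v⁻¹ = 1 := hfree _ c (by rw [mul_smul, hvg, inv_smul_smul])
  have := inv_mul_eq_one.mp hone
  rw [this, inv_inv]

section Decomposition

variable {R M ι : Type*} [Ring R] [AddCommGroup M] [Module R M] [DecidableEq ι]

/-- Two linear maps agreeing on every summand of an internal direct sum are equal. -/
theorem DirectSum.IsInternal.linearMap_ext {N : Type*} [AddCommGroup N] [Module R N]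
    {A : ι → Submodule R M} (hA : DirectSum.IsInternal A) {f g : M →ₗ[R] N}
    (h : ∀ c, ∀ x ∈ A c, f x = g x) : f = g := by
  have hle : (⊤ : Submodule R M) ≤ LinearMap.eqLocus f g := by
    rw [← hA.submodule_iSup_eq_top]
    exact iSup_le fun c x hx => h c x hx
  exact LinearMap.ext fun x => hle trivial

open Classical in
/-- The projection of an internal direct sum onto the summands indexed by `T`. -/
theorem DirectSum.IsInternal.exists_projection {A : ι → Submodule R M}
    (hA : DirectSum.IsInternal A) (T : Set ι) :
    ∃ e : M →ₗ[R] M, ∀ c, ∀ x ∈ A c, e x = if c ∈ T then x else 0 := by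
  let φ := LinearEquiv.ofBijective (DirectSum.coeLinearMap A) hA
  refine ⟨DirectSum.toModule R ι M (fun c => if c ∈ T then (A c).subtype else 0) ∘ₗ
    φ.symm.toLinearMap, fun c x hx => ?_⟩
  have hφ : φ.symm x = DirectSum.lof R ι (fun c => A c) c ⟨x, hx⟩ := by
    rw [LinearEquiv.symm_apply_eq]
    exact (DirectSum.coeLinearMap_lof A c ⟨x, hx⟩).symm
  rw [LinearMap.comp_apply, LinearEquiv.coe_coe, hφ, DirectSum.toModule_lof]
  split_ifs <;> simp

end Decomposition

/-- If `e` is an endomorphism whose conjugates under a finite group `W` form a complete system of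
orthogonal idempotents, then the module is isomorphic to `|W|` copies of its invariants. -/
theorem nonempty_linearEquiv_pi_invariants {R M W : Type*} [Ring R] [AddCommGroup M] [Module R M]
    [Group W] [Fintype W] (ρ : W →* (M ≃ₗ[R] M)) (e : M →ₗ[R] M)
    (hidem : ∀ x, e (e x) = e x) (horth : ∀ w : W, w ≠ 1 → ∀ x, e (ρ w (e x)) = 0)
    (hsum : ∀ x, ∑ w : W, ρ w (e (ρ w⁻¹ x)) = x)
    (Q : Submodule R M) (hQ : ∀ x, x ∈ Q ↔ ∀ w : W, ρ w x = x) :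
    Nonempty (M ≃ₗ[R] (W → Q)) := by
  classical
  have hρ : ∀ (v w : W) (x : M), ρ v (ρ w x) = ρ (v * w) x := fun v w x => by
    rw [map_mul, LinearEquiv.mul_apply]
  have hmem : ∀ x, (∑ g : W, (ρ g).toLinearMap ∘ₗ e) x ∈ Q := fun x => by
    rw [hQ]
    intro w
    simp only [LinearMap.sum_apply, LinearMap.comp_apply, LinearEquiv.coe_coe, map_sum, hρ]
    exact Fintype.sum_equiv (Equiv.mulLeft w) _ _ fun g => rfl
  have horth' : ∀ (v w : W) (x : M), e (ρ v⁻¹ (ρ w (e x))) = if w = v then e x else 0 := by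
    intro v w x
    rw [hρ]
    split_ifs with h
    · rw [h, inv_mul_cancel, map_one]
      exact hidem x
    · exact horth _ (fun h' => h (inv_mul_eq_one.mp h').symm) x
  let toFun : M →ₗ[R] (W → Q) := LinearMap.pi fun w =>
    ((∑ g : W, (ρ g).toLinearMap ∘ₗ e).codRestrict Q hmem) ∘ₗ (ρ w⁻¹).toLinearMap
  let invFun : (W → Q) →ₗ[R] M :=
    ∑ w : W, (ρ w).toLinearMap ∘ₗ e ∘ₗ Q.subtype ∘ₗ LinearMap.proj w
  refine ⟨LinearEquiv.ofLinearMap toFun invFun ?_ ?_⟩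
  · refine LinearMap.ext fun q => funext fun v => Subtype.ext ?_
    have hinv : ∀ w : W, ρ w (q v : M) = q v := (hQ _).mp (q v).2
    have := hsum (q v : M)
    simp only [hinv] at this
    simpa [toFun, invFun, map_sum, horth', -map_inv, apply_ite,
      Finset.sum_comm (s := Finset.univ (α := W))] using this
  · refine LinearMap.ext fun x => ?_
    have horth'' : ∀ (g : W) (y : M), e (ρ g (e y)) = if g = 1 then e y else 0 := by
      intro g y
      simpa using horth' 1 g y
    simpa [toFun, invFun, map_sum, horth''] using hsum x

/-- With `P = ⊕_{c ∈ π₀} P_c` an internal direct sum of `L`-submodules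
indexed by a finite set `π₀`, a finite group `W` acting on `P` by `L`-module automorphisms
(via `ρ`), acting freely on `π₀`, compatibly with the decomposition:  if `P` has finite
length as an `L`-module, then the `L`-submodule `P^W` of `W`-invariants also has finite
length, and `length_L(P) = |W| · length_L(P^W)`.  (Lengths are expressed via composition
series from `⊥` to `⊤`, which compute the length of a finite-length module.) -/
theorem stmt3 {k L P π₀ W : Type*} [Field k] [Ring L] [Algebra k L]
    [AddCommGroup P] [Module L P] [DecidableEq π₀] [Finite π₀]
    [Group W] [Finite W] [MulAction W π₀]
    (Pc : π₀ → Submodule L P) (hdecomp : DirectSum.IsInternal Pc)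
    (ρ : W →* (P ≃ₗ[L] P))
    (hfree : ∀ (w : W) (c : π₀), w • c = c → w = 1)
    (hcompat : ∀ (w : W) (c : π₀), ∀ x ∈ Pc c, ρ w x ∈ Pc (w • c))
    (hlen : IsFiniteLength L P)
    (Q : Submodule L P) (hQ : (Q : Set P) = {x : P | ∀ w : W, ρ w x = x}) :
    IsFiniteLength L Q ∧
    ∀ (s : CompositionSeries (Submodule L P)) (u : CompositionSeries (Submodule L Q)),
      s.head = ⊥ → s.last = ⊤ → u.head = ⊥ → u.last = ⊤ →
      s.length = Nat.card W * u.length := by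
  classical
  have := Fintype.ofFinite W
  obtain ⟨T, hT⟩ := MulAction.exists_transversal_of_free hfree
  obtain ⟨e, he⟩ := hdecomp.exists_projection T
  have hidem : ∀ x, e (e x) = e x := by
    refine LinearMap.congr_fun (f := e ∘ₗ e) (hdecomp.linearMap_ext fun c x hx => ?_)
    by_cases hc : c ∈ T <;> simp [he c x hx, hc]
  have horth : ∀ w : W, w ≠ 1 → ∀ x, e (ρ w (e x)) = 0 := by
    intro w hw
    refine LinearMap.congr_fun (f := e ∘ₗ (ρ w).toLinearMap ∘ₗ e) (g := 0)
      (hdecomp.linearMap_ext fun c x hx => ?_)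
    by_cases hc : c ∈ T
    · have hwc : w • c ∉ T := fun h => hw <| inv_eq_one.mp <|
        (hT c).unique (by simpa using h) (by simpa using hc)
      simp [he c x hx, hc, he _ _ (hcompat w c x hx), hwc]
    · simp [he c x hx, hc]
  have hsum : ∀ x, ∑ w : W, ρ w (e (ρ w⁻¹ x)) = x := by
    have hmap : ∑ w : W, (ρ w).toLinearMap ∘ₗ e ∘ₗ (ρ w⁻¹).toLinearMap = LinearMap.id := by
      refine hdecomp.linearMap_ext fun c x hx => ?_
      obtain ⟨v, hv, hv'⟩ := hT c
      have hterm : ∀ w : W, ρ w (e (ρ w⁻¹ x)) = if w = v then x else 0 := by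
        intro w
        rw [he _ _ (hcompat w⁻¹ c x hx)]
        by_cases hw : w = v
        · subst hw
          rw [if_pos hv, if_pos rfl, ← LinearEquiv.mul_apply, ← map_mul, mul_inv_cancel, map_one]
          rfl
        · rw [if_neg fun h => hw (hv' w h), if_neg hw, map_zero]
      simp only [LinearMap.sum_apply, LinearMap.comp_apply, LinearEquiv.coe_coe, hterm]
      simp
    intro x
    simpa only [LinearMap.sum_apply, LinearMap.comp_apply, LinearEquiv.coe_coe,
      LinearMap.id_apply] using LinearMap.congr_fun hmap x
  obtain ⟨φ⟩ := nonempty_linearEquiv_pi_invariants ρ e hidem horth hsum Q (Set.ext_iff.mp hQ)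
  refine ⟨hlen.of_injective Q.injective_subtype, fun s u hs hs' hu hu' => ?_⟩
  have h := φ.length_eq
  rw [Module.length_pi, ← Module.length_compositionSeries s hs hs',
    ← Module.length_compositionSeries u hu hu', ENat.card_eq_coe_natCard] at h
  exact_mod_cast h
end

section
/- Suppose the Krull dimension of R/Ann_R(M) equals the natural number d. Then there exists a positive rational number q such that (1 − t)^d · P_M(t) → q as t → 1 from the left (t real, 0 ≤ t < 1). (This q is by definition the degree deg(M) of M.) -/
theorem ringKrullDim_eq_of_isIntegral_of_injective {A B : Type*} [CommRing A] [CommRing B]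
    [Algebra A B] [Algebra.IsIntegral A B] (hinj : Function.Injective (algebraMap A B)) :
    ringKrullDim A = ringKrullDim B := by
  apply le_antisymm
  · refine iSup_le fun l => ?_
    obtain ⟨P, -, hP, hPl⟩ := Ideal.exists_ideal_over_prime_of_isIntegral l.head.asIdeal
      (⊥ : Ideal B) (by
        intro x hx
        have hx0 : algebraMap A B x = 0 := by simpa using hx
        rw [(injective_iff_map_eq_zero _).mp hinj x hx0]
        exact zero_mem _)
    have : P.LiesOver (RelSeries.head l).asIdeal := ⟨hPl.symm⟩
    obtain ⟨L, hL, -, -⟩ := Ideal.exists_ltSeries_of_hasGoingUp l P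
    rw [← hL]
    exact le_sSup ⟨L, rfl⟩
  · exact Order.krullDim_le_of_strictMono (PrimeSpectrum.comap (algebraMap A B))
      fun I J hIJ => Ideal.IsIntegral.comap_lt_comap (R := A) hIJ

theorem exists_mvPolynomial_algHom_faithful_finite {k R M : Type*} [Field k] [CommRing R]
    [Algebra k R] [Algebra.FiniteType k R] [AddCommGroup M] [Module R M] [Module.Finite R M]
    [Nontrivial M] (d : ℕ) (hdim : ringKrullDim (R ⧸ Module.annihilator R M) = d) :
    ∃ φ : MvPolynomial (Fin d) k →ₐ[k] R,
      (∀ a, (∀ m : M, φ a • m = 0) → a = 0) ∧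
      ∃ (r : ℕ) (g : Fin r → M), ∀ m, ∃ c : Fin r → MvPolynomial (Fin d) k,
        m = ∑ i, φ (c i) • g i := by
  set I := Module.annihilator R M
  have hI : Nontrivial (R ⧸ I) := by
    refine Ideal.Quotient.nontrivial_iff.mpr fun h => ?_
    obtain ⟨m, hm⟩ := exists_ne (0 : M)
    have h1 : (1 : R) ∈ I := h ▸ Submodule.mem_top
    exact hm (by simpa using Module.mem_annihilator.mp h1 m)
  obtain ⟨s, g, hg, hfin⟩ := exists_finite_inj_algHom_of_fg k (R ⧸ I)
  have hs : s = d := by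
    let := g.toRingHom.toAlgebra
    have : Module.Finite (MvPolynomial (Fin s) k) (R ⧸ I) := hfin
    have h := ringKrullDim_eq_of_isIntegral_of_injective (A := MvPolynomial (Fin s) k)
      (B := R ⧸ I) hg
    rw [hdim, MvPolynomial.ringKrullDim_of_isNoetherianRing, ringKrullDim_eq_zero_of_field] at h
    simp only [Nat.card_eq_fintype_card, Fintype.card_fin, zero_add] at h
    exact_mod_cast h
  subst hs
  choose y hy using fun i => Ideal.Quotient.mk_surjective (I := I) (g (MvPolynomial.X i))
  let φ : MvPolynomial (Fin s) k →ₐ[k] R := MvPolynomial.aeval y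
  have hφ : (Ideal.Quotient.mkₐ k I).comp φ = g := by
    ext i
    simp [φ, hy]
  have hφ' : ∀ a, Ideal.Quotient.mk I (φ a) = g a := fun a => DFunLike.congr_fun hφ a
  refine ⟨φ, fun a ha => ?_, ?_⟩
  · apply hg
    rw [map_zero, ← hφ', Ideal.Quotient.eq_zero_iff_mem]
    exact Module.mem_annihilator.mpr ha
  · let := g.toRingHom.toAlgebra
    have : Module.Finite (MvPolynomial (Fin s) k) (R ⧸ I) := hfin
    let : Module (R ⧸ I) M := Module.quotientAnnihilator
    let : Module (MvPolynomial (Fin s) k) M := Module.compHom M g.toRingHom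
    have : IsScalarTower (MvPolynomial (Fin s) k) (R ⧸ I) M :=
      ⟨fun a b m => mul_smul (g a) b m⟩
    have : IsScalarTower R (R ⧸ I) M := ⟨fun a b m => by
      obtain ⟨b, rfl⟩ := Ideal.Quotient.mk_surjective b
      exact mul_smul a b m⟩
    have : Module.Finite (R ⧸ I) M := Module.Finite.of_restrictScalars_finite R (R ⧸ I) M
    have : Module.Finite (MvPolynomial (Fin s) k) M := Module.Finite.trans (R ⧸ I) M
    obtain ⟨r, e, he⟩ := Module.Finite.exists_fin (R := MvPolynomial (Fin s) k) (M := M)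
    refine ⟨r, e, fun m => ?_⟩
    obtain ⟨c, hc⟩ := (Submodule.mem_span_range_iff_exists_fun _).mp
      (he ▸ Submodule.mem_top : m ∈ _)
    refine ⟨c, hc ▸ Finset.sum_congr rfl fun i _ => ?_⟩
    change g (c i) • e i = _
    rw [← hφ']
    rfl

section BoxPolynomials

variable (k : Type*) [Field k] (d N : ℕ)

theorem nonempty_basis_restrictDegree :
    Nonempty (Module.Basis (Fin d → Fin (N + 1)) k (MvPolynomial.restrictDegree (Fin d) k N)) := by
  refine ⟨(MvPolynomial.basisRestrictSupport k {n : Fin d →₀ ℕ | ∀ i, n i ≤ N}).reindex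
    { toFun := fun n i => ⟨n.1 i, Nat.lt_succ_of_le (n.2 i)⟩
      invFun := fun f => ⟨Finsupp.equivFunOnFinite.symm fun i => (f i : ℕ),
        fun i => Nat.le_of_lt_succ (f i).2⟩
      left_inv := fun n => by ext; simp
      right_inv := fun f => by ext; simp }⟩

instance finiteDimensional_restrictDegree :
    FiniteDimensional k (MvPolynomial.restrictDegree (Fin d) k N) :=
  (nonempty_basis_restrictDegree k d N).some.finiteDimensional_of_finite

theorem finrank_restrictDegree :
    Module.finrank k (MvPolynomial.restrictDegree (Fin d) k N) = (N + 1) ^ d := by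
  rw [Module.finrank_eq_card_basis (nonempty_basis_restrictDegree k d N).some]
  simp

variable {k d N}

theorem restrictDegree_mono {N' : ℕ} (h : N ≤ N') :
    MvPolynomial.restrictDegree (Fin d) k N ≤ MvPolynomial.restrictDegree (Fin d) k N' :=
  MvPolynomial.restrictSupport_mono _ fun _ hn i => (hn i).trans h

theorem mul_mem_restrictDegree {N' : ℕ} {p q : MvPolynomial (Fin d) k}
    (hp : p ∈ MvPolynomial.restrictDegree (Fin d) k N)
    (hq : q ∈ MvPolynomial.restrictDegree (Fin d) k N') :
    p * q ∈ MvPolynomial.restrictDegree (Fin d) k (N + N') := by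
  rw [MvPolynomial.mem_restrictDegree] at *
  intro s hs i
  refine (MvPolynomial.degreeOf_le_iff.mp (MvPolynomial.degreeOf_mul_le i p q) s hs).trans ?_
  exact add_le_add (MvPolynomial.degreeOf_le_iff.mpr fun m hm => hp m hm i)
    (MvPolynomial.degreeOf_le_iff.mpr fun m hm => hq m hm i)

theorem exists_mem_restrictDegree (p : MvPolynomial (Fin d) k) :
    ∃ N, p ∈ MvPolynomial.restrictDegree (Fin d) k N :=
  ⟨p.totalDegree, MvPolynomial.restrictTotalDegree_le_restrictDegree _ _ _
    ((MvPolynomial.mem_restrictTotalDegree _ _ _).mpr le_rfl)⟩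

end BoxPolynomials

section GradedComponent

variable {k R M : Type*} [Field k] [CommRing R] [Algebra k R]
  [AddCommGroup M] [Module R M] [Module k M]

/-- The projection of a graded module onto its component of degree `i`, as an endomorphism. -/
noncomputable def gradedComponent (ℳ : ℕ → Submodule k M) [DirectSum.Decomposition ℳ] (i : ℕ) :
    M →ₗ[k] M :=
  (ℳ i).subtype ∘ₗ DirectSum.component k ℕ (fun i => ℳ i) i ∘ₗ
    (DirectSum.decomposeLinearEquiv ℳ).toLinearMap

variable {ℳ : ℕ → Submodule k M} [DirectSum.Decomposition ℳ]

theorem gradedComponent_apply (i : ℕ) (m : M) :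
    gradedComponent ℳ i m = (DirectSum.decompose ℳ m i : M) := rfl

theorem gradedComponent_mem (i : ℕ) (m : M) : gradedComponent ℳ i m ∈ ℳ i := by
  rw [gradedComponent_apply]; exact SetLike.coe_mem _

theorem gradedComponent_of_mem {i : ℕ} {m : M} (hm : m ∈ ℳ i) : gradedComponent ℳ i m = m := by
  rw [gradedComponent_apply, DirectSum.decompose_of_mem_same ℳ hm]

theorem gradedComponent_of_mem_ne {i j : ℕ} {m : M} (hm : m ∈ ℳ i) (hij : i ≠ j) :
    gradedComponent ℳ j m = 0 := by
  rw [gradedComponent_apply, DirectSum.decompose_of_mem_ne ℳ hm hij]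

variable {𝒜 : ℕ → Submodule k R} [SetLike.GradedSMul 𝒜 ℳ]

theorem gradedComponent_add_smul {e : ℕ} {x : R} (hx : x ∈ 𝒜 e) (i : ℕ) (m : M) :
    gradedComponent ℳ (i + e) (x • m) = x • gradedComponent ℳ i m := by
  induction m using DirectSum.Decomposition.inductionOn ℳ with
  | zero => simp
  | @homogeneous j m =>
    have h : x • (m : M) ∈ ℳ (e + j) := SetLike.GradedSMul.smul_mem hx m.2
    by_cases hij : j = i
    · subst hij
      rw [gradedComponent_of_mem m.2, gradedComponent_of_mem (add_comm e j ▸ h)]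
    · rw [gradedComponent_of_mem_ne m.2 hij, gradedComponent_of_mem_ne h (by omega), smul_zero]
  | add m m' h h' => simp only [smul_add, map_add, h, h']

theorem gradedComponent_smul_of_lt {e : ℕ} {x : R} (hx : x ∈ 𝒜 e) {i : ℕ} (hi : i < e) (m : M) :
    gradedComponent ℳ i (x • m) = 0 := by
  induction m using DirectSum.Decomposition.inductionOn ℳ with
  | zero => simp
  | @homogeneous j m =>
    have h : x • (m : M) ∈ ℳ (e + j) := SetLike.GradedSMul.smul_mem hx m.2
    exact gradedComponent_of_mem_ne h (by omega)
  | add m m' h h' => simp only [smul_add, map_add, h, h', add_zero]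

/-- The subspace of elements of degree at most `n`. -/
def degreeLESubmodule (ℳ : ℕ → Submodule k M) [DirectSum.Decomposition ℳ] (n : ℕ) :
    Submodule k M where
  carrier := {m | ∀ i, n < i → gradedComponent ℳ i m = 0}
  zero_mem' := fun i _ => map_zero _
  add_mem' := fun ha hb i hi => by rw [map_add, ha i hi, hb i hi, add_zero]
  smul_mem' := fun c m hm i hi => by rw [map_smul, hm i hi, smul_zero]

theorem degreeLESubmodule_mono {n n' : ℕ} (h : n ≤ n') :
    degreeLESubmodule ℳ n ≤ degreeLESubmodule ℳ n' := fun _ hm i hi => hm i (by omega)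

theorem le_degreeLESubmodule (n : ℕ) : ℳ n ≤ degreeLESubmodule ℳ n :=
  fun _ hm _ hi => gradedComponent_of_mem_ne hm hi.ne

theorem exists_mem_degreeLESubmodule (m : M) : ∃ n, m ∈ degreeLESubmodule ℳ n := by
  induction m using DirectSum.Decomposition.inductionOn ℳ with
  | zero => exact ⟨0, zero_mem _⟩
  | @homogeneous j m => exact ⟨j, le_degreeLESubmodule j m.2⟩
  | add m m' h h' =>
    obtain ⟨a, ha⟩ := h
    obtain ⟨b, hb⟩ := h'
    exact ⟨max a b, add_mem (degreeLESubmodule_mono (le_max_left _ _) ha)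
      (degreeLESubmodule_mono (le_max_right _ _) hb)⟩

theorem sum_gradedComponent {n : ℕ} {m : M} (hm : m ∈ degreeLESubmodule ℳ n) :
    ∑ i ∈ Finset.range (n + 1), gradedComponent ℳ i m = m := by
  classical
  conv_rhs => rw [← DirectSum.sum_support_decompose ℳ m]
  refine (Finset.sum_subset (fun i hi => ?_) fun i _ hi => ?_).symm
  · rw [Finset.mem_range]
    by_contra h
    have := hm i (by omega)
    rw [gradedComponent_apply] at this
    simp at hi
    exact hi (by exact_mod_cast this)
  · rw [DFinsupp.notMem_support_iff] at hi
    rw [gradedComponent_apply, hi]; rfl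

theorem ext_gradedComponent {m m' : M}
    (h : ∀ i, gradedComponent ℳ i m = gradedComponent ℳ i m') : m = m' := by
  apply (DirectSum.decompose ℳ).injective
  ext i
  exact h i

variable [GradedAlgebra 𝒜]

theorem smul_mem_degreeLESubmodule {a b : ℕ} {r : R} {m : M} (hr : r ∈ degreeLESubmodule 𝒜 a)
    (hm : m ∈ degreeLESubmodule ℳ b) : r • m ∈ degreeLESubmodule ℳ (a + b) := by
  rw [← sum_gradedComponent hr, Finset.sum_smul]
  refine sum_mem fun i hi j hj => ?_
  have hi' := Finset.mem_range.mp hi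
  obtain ⟨j, rfl⟩ : ∃ j', j = j' + i := ⟨j - i, by omega⟩
  rw [gradedComponent_add_smul (gradedComponent_mem i r), hm j (by omega), smul_zero]

theorem finrank_le_sum_of_le_degreeLESubmodule (hfin : ∀ i, FiniteDimensional k (ℳ i)) {n : ℕ}
    {V : Type*} [AddCommGroup V] [Module k V] (f : V →ₗ[k] M) (hf : Function.Injective f)
    (hV : ∀ v, f v ∈ degreeLESubmodule ℳ n) :
    Module.finrank k V ≤ ∑ i ∈ Finset.range (n + 1), Module.finrank k (ℳ i) := by
  rw [Finset.sum_range, ← Module.finrank_pi_fintype k (M := fun i : Fin (n + 1) => ℳ i)]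
  refine LinearMap.finrank_le_finrank_of_injective
    (f := LinearMap.pi fun i : Fin (n + 1) =>
      ((gradedComponent ℳ i).codRestrict (ℳ i) (gradedComponent_mem _)) ∘ₗ f) ?_
  intro v w hvw
  refine hf (ext_gradedComponent (ℳ := ℳ) fun i => ?_)
  by_cases hi : n < i
  · rw [hV v i hi, hV w i hi]
  · exact congrArg Subtype.val (congrFun hvw ⟨i, by omega⟩)

theorem sum_finrank_le_of_le (hfin : ∀ i, FiniteDimensional k (ℳ i)) {n : ℕ} {U : Submodule k M}
    [FiniteDimensional k U] (hU : ∀ i ≤ n, ℳ i ≤ U) :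
    ∑ i ∈ Finset.range (n + 1), Module.finrank k (ℳ i) ≤ Module.finrank k U := by
  rw [Finset.sum_range, ← Module.finrank_pi_fintype k (M := fun i : Fin (n + 1) => ℳ i)]
  let f : (∀ i : Fin (n + 1), ℳ i) →ₗ[k] M :=
    ∑ i : Fin (n + 1), (ℳ i).subtype ∘ₗ LinearMap.proj i
  have hf : ∀ v, f v = ∑ i : Fin (n + 1), (v i : M) := fun v => by simp [f]
  refine LinearMap.finrank_le_finrank_of_injective (f := f.codRestrict U fun v => ?_) ?_
  · rw [hf]
    exact sum_mem fun i _ => hU i (by omega) (v i).2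
  · intro v w hvw
    have h : f v = f w := congrArg Subtype.val hvw
    have key : ∀ (v : ∀ i : Fin (n + 1), ℳ i) (j : Fin (n + 1)),
        gradedComponent ℳ j (f v) = v j := by
      intro v j
      rw [hf, map_sum, Finset.sum_eq_single j]
      · exact gradedComponent_of_mem (v j).2
      · exact fun i _ hij => gradedComponent_of_mem_ne (v i).2 fun h => hij (Fin.ext h)
      · simp
    ext j
    rw [← key v, ← key w, h]

end GradedComponent

section Generators

variable {k R M : Type*} [Field k] [CommRing R] [Algebra k R]
  [AddCommGroup M] [Module R M] [Module k M]

theorem exists_finset_homogeneous_span [IsNoetherianRing R]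
    (𝒜 : ℕ → Submodule k R) [GradedAlgebra 𝒜] :
    ∃ (s : Finset R) (e : R → ℕ), (∀ x ∈ s, 0 < e x ∧ x ∈ 𝒜 (e x)) ∧
      ∀ n, 0 < n → ∀ a ∈ 𝒜 n, a ∈ Ideal.span (s : Set R) := by
  obtain ⟨s, hs, hspan⟩ := (Submodule.fg_span_iff_fg_span_finset_subset
    (R := R) (⋃ i > 0, (𝒜 i : Set R))).mp (IsNoetherian.noetherian _)
  have h : ∀ x ∈ s, ∃ e, 0 < e ∧ x ∈ 𝒜 e := by
    intro x hx
    simpa using hs hx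
  choose! e he using h
  refine ⟨s, e, he, fun n hn a ha => ?_⟩
  change a ∈ Submodule.span R (s : Set R)
  rw [← hspan]
  exact Submodule.subset_span (Set.mem_biUnion (x := n) hn ha)

variable {𝒜 : ℕ → Submodule k R} {ℳ : ℕ → Submodule k M} [DirectSum.Decomposition ℳ]
  [SetLike.GradedSMul 𝒜 ℳ]

theorem gradedComponent_mem_of_mem_span_smul {s : Finset R} {e : R → ℕ}
    (hs : ∀ x ∈ s, 0 < e x ∧ x ∈ 𝒜 (e x)) {n : ℕ} {P : AddSubmonoid M}
    (hP : ∀ x ∈ s, ∀ i, i + e x = n → ∀ m ∈ ℳ i, x • m ∈ P) {m : M}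
    (hm : m ∈ Ideal.span (s : Set R) • (⊤ : Submodule R M)) :
    gradedComponent ℳ n m ∈ P := by
  induction hm using Submodule.smul_induction_on' with
  | smul a ha m _ =>
    obtain ⟨f, -, rfl⟩ := Submodule.mem_span_finset.mp ha
    rw [Finset.sum_smul, map_sum]
    refine sum_mem fun x hx => ?_
    rw [smul_eq_mul, mul_comm, mul_smul]
    by_cases h : e x ≤ n
    · obtain ⟨i, rfl⟩ : ∃ i, n = i + e x := ⟨n - e x, by omega⟩
      rw [gradedComponent_add_smul (hs x hx).2]
      exact hP x hx i rfl _ (gradedComponent_mem _ _)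
    · rw [gradedComponent_smul_of_lt (hs x hx).2 (by omega)]
      exact zero_mem _
  | add m _ m' _ h h' =>
    rw [map_add]
    exact add_mem h h'

variable [GradedAlgebra 𝒜]

theorem finiteType_of_graded [FiniteDimensional k (𝒜 0)] {s : Finset R} {e : R → ℕ}
    (hs : ∀ x ∈ s, 0 < e x ∧ x ∈ 𝒜 (e x))
    (hspan : ∀ n, 0 < n → ∀ a ∈ 𝒜 n, a ∈ Ideal.span (s : Set R)) : Algebra.FiniteType k R := by
  classical
  obtain ⟨t, ht⟩ := (Submodule.fg_iff_finiteDimensional (𝒜 0)).mpr inferInstance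
  refine ⟨⟨s ∪ t, ?_⟩⟩
  set T := Algebra.adjoin k ((s ∪ t : Finset R) : Set R)
  have hsub : ((s ∪ t : Finset R) : Set R) ⊆ T := Algebra.subset_adjoin
  have key : ∀ n, ∀ a ∈ 𝒜 n, a ∈ T := by
    intro n
    induction n using Nat.strong_induction_on with
    | _ n ih =>
      intro a ha
      rcases Nat.eq_zero_or_pos n with rfl | hn
      · have h0 : 𝒜 0 ≤ Subalgebra.toSubmodule T := by
          rw [← ht]
          exact Submodule.span_le.mpr fun x hx => hsub (by simp [Finset.mem_coe.mp hx])
        exact h0 ha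
      · rw [← gradedComponent_of_mem ha]
        refine gradedComponent_mem_of_mem_span_smul (P := T.toSubmodule.toAddSubmonoid) hs ?_
          (by simpa using hspan n hn a ha)
        intro x hx i hi m hm
        exact T.mul_mem (hsub (by simp [hx])) (ih i (by have := (hs x hx).1; omega) m hm)
  rw [eq_top_iff]
  intro a _
  induction a using DirectSum.Decomposition.inductionOn 𝒜 with
  | zero => exact zero_mem _
  | homogeneous m => exact key _ _ m.2
  | add m m' h h' => exact add_mem (h trivial) (h' trivial)

theorem exists_mem_span_smul_of_lt_degree [IsNoetherian R M] {s : Set R}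
    (hspan : ∀ n, 0 < n → ∀ a ∈ 𝒜 n, a ∈ Ideal.span s)
    {N : Submodule R M} (hN : ∀ m ∈ N, ∀ i, gradedComponent ℳ i m ∈ N) :
    ∃ D, ∀ n, D < n → ∀ m ∈ N, m ∈ ℳ n → m ∈ Ideal.span s • N := by
  obtain ⟨G, rfl⟩ := IsNoetherian.noetherian N
  choose b hb using fun g : M => exists_mem_degreeLESubmodule (ℳ := ℳ) g
  refine ⟨G.sup b, fun n hn m hm hmn => ?_⟩
  rw [← gradedComponent_of_mem hmn]
  obtain ⟨f, -, rfl⟩ := Submodule.mem_span_finset.mp hm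
  rw [map_sum]
  refine sum_mem fun g hg => ?_
  have hgb : g ∈ degreeLESubmodule ℳ (G.sup b) :=
    degreeLESubmodule_mono (Finset.le_sup hg) (hb g)
  generalize f g = r
  induction r using DirectSum.Decomposition.inductionOn 𝒜 with
  | zero => simp
  | @homogeneous a r =>
    by_cases h : a ≤ n
    · obtain ⟨i, rfl⟩ : ∃ i, n = i + a := ⟨n - a, by omega⟩
      rw [gradedComponent_add_smul r.2]
      rcases Nat.eq_zero_or_pos a with rfl | ha
      · rw [hgb i (by omega), smul_zero]
        exact zero_mem _
      · exact Submodule.smul_mem_smul (hspan a ha r r.2)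
          (hN g (Submodule.subset_span hg) i)
    · rw [gradedComponent_smul_of_lt r.2 (by omega)]
      exact zero_mem _
  | add r r' h h' =>
    rw [add_smul, map_add]
    exact add_mem h h'

end Generators

section Growth

variable {k R M : Type*} [Field k] [CommRing R] [Algebra k R]
  [AddCommGroup M] [Module R M] [Module k M] [IsScalarTower k R M]
  {ℳ : ℕ → Submodule k M} [DirectSum.Decomposition ℳ] {d : ℕ}

theorem exists_pow_le_sum_finrank (𝒜 : ℕ → Submodule k R) [GradedAlgebra 𝒜]
    [SetLike.GradedSMul 𝒜 ℳ] (hfin : ∀ i, FiniteDimensional k (ℳ i))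
    {φ : MvPolynomial (Fin d) k →ₐ[k] R} (hφ : ∀ a, (∀ m : M, φ a • m = 0) → a = 0)
    {r : ℕ} {g : Fin r → M}
    (hg : ∀ m, ∃ c : Fin r → MvPolynomial (Fin d) k, m = ∑ i, φ (c i) • g i) :
    ∃ a b : ℕ, 0 < a ∧ ∀ n,
      (n + 1) ^ d ≤ ∑ i ∈ Finset.range (a * n + b + 1), Module.finrank k (ℳ i) := by
  obtain ⟨m₀, hm₀⟩ : ∃ m₀ : M, ∀ a, φ a • m₀ = 0 → a = 0 := by
    by_contra! h
    choose a ha ha0 using h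
    refine Finset.prod_ne_zero_iff.mpr (fun i (_ : i ∈ Finset.univ) => ha0 (g i))
      (hφ (∏ i, a (g i)) fun m => ?_)
    obtain ⟨c, rfl⟩ := hg m
    rw [Finset.smul_sum]
    refine Finset.sum_eq_zero fun i _ => ?_
    rw [smul_smul, ← map_mul, ← Finset.prod_erase_mul _ _ (Finset.mem_univ i), mul_assoc,
      mul_comm (a (g i)), ← mul_assoc, map_mul, mul_smul, ha, smul_zero]
  obtain ⟨b, hb⟩ := exists_mem_degreeLESubmodule (ℳ := ℳ) m₀
  choose e he using fun i : Fin d =>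
    exists_mem_degreeLESubmodule (ℳ := 𝒜) (φ (MvPolynomial.X i))
  have hone : (1 : R) ∈ degreeLESubmodule 𝒜 0 :=
    le_degreeLESubmodule 0 SetLike.GradedOne.one_mem
  have hpow : ∀ (i : Fin d) (n : ℕ),
      φ (MvPolynomial.X i) ^ n ∈ degreeLESubmodule 𝒜 (n * e i) := by
    intro i n
    induction n with
    | zero => simpa using hone
    | succ n ih =>
      rw [pow_succ, Nat.succ_mul]
      exact smul_mem_degreeLESubmodule ih (he i)
  have hprod : ∀ (t : Finset (Fin d)) (n : Fin d → ℕ),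
      ∏ i ∈ t, φ (MvPolynomial.X i) ^ n i ∈ degreeLESubmodule 𝒜 (∑ i ∈ t, n i * e i) := by
    classical
    intro t n
    induction t using Finset.induction_on with
    | empty => simpa using hone
    | insert i t hi ih =>
      rw [Finset.prod_insert hi, Finset.sum_insert hi]
      exact smul_mem_degreeLESubmodule (hpow i (n i)) ih
  have hbox : ∀ n, ∀ p ∈ MvPolynomial.restrictDegree (Fin d) k n,
      φ p ∈ degreeLESubmodule 𝒜 ((∑ i, e i + 1) * n) := by
    intro n p hp
    rw [p.as_sum, map_sum]
    refine sum_mem fun v hv => ?_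
    rw [MvPolynomial.monomial_eq, ← MvPolynomial.smul_eq_C_mul, map_smul]
    refine Submodule.smul_mem _ _ ?_
    rw [Finsupp.prod_fintype _ _ (by simp), map_prod]
    simp only [map_pow]
    refine degreeLESubmodule_mono ?_ (hprod Finset.univ v)
    rw [MvPolynomial.mem_restrictDegree] at hp
    calc ∑ i, v i * e i ≤ ∑ i, n * e i :=
          Finset.sum_le_sum fun i _ => Nat.mul_le_mul_right _ (hp v hv i)
      _ = n * ∑ i, e i := (Finset.mul_sum _ _ _).symm
      _ ≤ (∑ i, e i + 1) * n := by nlinarith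
  refine ⟨∑ i, e i + 1, b, by omega, fun n => ?_⟩
  rw [← finrank_restrictDegree k d n]
  let f : MvPolynomial (Fin d) k →ₗ[k] M :=
    (LinearMap.toSpanSingleton R M m₀).restrictScalars k ∘ₗ φ.toLinearMap
  refine finrank_le_sum_of_le_degreeLESubmodule (ℳ := ℳ) hfin
    (f ∘ₗ (MvPolynomial.restrictDegree (Fin d) k n).subtype) ?_ fun p =>
      smul_mem_degreeLESubmodule (𝒜 := 𝒜) (hbox n p p.2) hb
  rw [injective_iff_map_eq_zero]
  intro p hp
  exact Subtype.ext (hm₀ p hp)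

variable {𝒜 : ℕ → Submodule k R} [GradedAlgebra 𝒜] [SetLike.GradedSMul 𝒜 ℳ]

theorem exists_sum_finrank_le_pow [IsNoetherian R M] (hfin : ∀ i, FiniteDimensional k (ℳ i))
    {s : Finset R} {e : R → ℕ} (hs : ∀ x ∈ s, 0 < e x ∧ x ∈ 𝒜 (e x))
    (hspan : ∀ n, 0 < n → ∀ a ∈ 𝒜 n, a ∈ Ideal.span (s : Set R))
    {φ : MvPolynomial (Fin d) k →ₐ[k] R} {r : ℕ} {g : Fin r → M}
    (hg : ∀ m, ∃ c : Fin r → MvPolynomial (Fin d) k, m = ∑ i, φ (c i) • g i) :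
    ∃ K : ℕ, ∀ n,
      ∑ i ∈ Finset.range (n + 1), Module.finrank k (ℳ i) ≤ K * (n + 1) ^ d := by
  let P := fun N => MvPolynomial.restrictDegree (Fin d) k N
  let f : (Fin r → MvPolynomial (Fin d) k) →ₗ[k] M :=
    ∑ i, (LinearMap.toSpanSingleton R M (g i)).restrictScalars k ∘ₗ φ.toLinearMap ∘ₗ
      LinearMap.proj i
  have hf : ∀ c, f c = ∑ i, φ (c i) • g i := fun c => by simp [f]
  let F : ∀ N, (Fin r → P N) →ₗ[k] M := fun N =>
    f ∘ₗ LinearMap.pi fun i => (P N).subtype ∘ₗ LinearMap.proj i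
  have hF : ∀ N c, F N c = ∑ i, φ (c i) • g i := fun N c => hf _
  let U : ℕ → Submodule k M := fun N => LinearMap.range (F N)
  have mem_U : ∀ {N : ℕ} {c : Fin r → MvPolynomial (Fin d) k}, (∀ i, c i ∈ P N) →
      ∑ i, φ (c i) • g i ∈ U N := fun {N c} hc => ⟨fun i => ⟨c i, hc i⟩, hF N _⟩
  have U_mono : ∀ {N N'}, N ≤ N' → U N ≤ U N' := by
    rintro N N' h _ ⟨c, rfl⟩
    rw [hF]
    exact mem_U fun i => restrictDegree_mono h (c i).2
  have U_all : ∀ m, ∃ N, m ∈ U N := by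
    intro m
    obtain ⟨c, rfl⟩ := hg m
    choose N hN using fun i => exists_mem_restrictDegree (c i)
    exact ⟨Finset.univ.sup N, mem_U fun i =>
      restrictDegree_mono (Finset.le_sup (Finset.mem_univ i)) (hN i)⟩
  have U_finset : ∀ t : Finset M, ∃ N, ∀ m ∈ t, m ∈ U N := by
    intro t
    choose N hN using U_all
    exact ⟨t.sup N, fun m hm => U_mono (Finset.le_sup hm) (hN m)⟩
  have φ_smul_U : ∀ {N N' p m}, p ∈ P N → m ∈ U N' → φ p • m ∈ U (N + N') := by
    rintro N N' p _ hp ⟨c, rfl⟩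
    rw [hF, Finset.smul_sum]
    simp only [smul_smul, ← map_mul]
    exact mem_U fun i => mul_mem_restrictDegree hp (c i).2
  obtain ⟨c, hc⟩ : ∃ c, ∀ x ∈ s, ∀ N, ∀ m ∈ U N, x • m ∈ U (N + c) := by
    classical
    obtain ⟨c, hc⟩ := U_finset (Finset.image₂ (fun x i => x • g i) s Finset.univ)
    refine ⟨c, ?_⟩
    rintro x hx N _ ⟨v, rfl⟩
    rw [hF, Finset.smul_sum]
    refine sum_mem fun i _ => ?_
    rw [smul_comm]
    exact φ_smul_U (v i).2 (hc _ (Finset.mem_image₂_of_mem hx (Finset.mem_univ i)))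
  obtain ⟨D, hD⟩ := exists_mem_span_smul_of_lt_degree (ℳ := ℳ) (N := ⊤) hspan
    (fun _ _ _ => trivial)
  obtain ⟨c₀, hc₀⟩ : ∃ c₀, ∀ n ≤ D, ℳ n ≤ U c₀ := by
    choose t ht using fun n => (Submodule.fg_iff_finiteDimensional (ℳ n)).mpr (hfin n)
    classical
    obtain ⟨c₀, h⟩ := U_finset ((Finset.range (D + 1)).biUnion t)
    refine ⟨c₀, fun n hn => ?_⟩
    rw [← ht n, Submodule.span_le]
    exact fun m hm => h m (Finset.mem_biUnion.mpr ⟨n, Finset.mem_range.mpr (by omega), hm⟩)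
  have key : ∀ n, ℳ n ≤ U (c * n + c₀) := by
    intro n
    induction n using Nat.strong_induction_on with
    | _ n ih =>
      by_cases hn : n ≤ D
      · exact (hc₀ n hn).trans (U_mono (by omega))
      intro m hm
      rw [← gradedComponent_of_mem hm]
      refine gradedComponent_mem_of_mem_span_smul (P := (U (c * n + c₀)).toAddSubmonoid) hs ?_
        (hD n (by omega) m trivial hm)
      rintro x hx i rfl m hm
      have hpos := (hs x hx).1
      refine U_mono ?_ (hc x hx _ m (ih i (by omega) hm))
      nlinarith
  refine ⟨r * (c + c₀ + 1) ^ d, fun n => ?_⟩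
  calc ∑ i ∈ Finset.range (n + 1), Module.finrank k (ℳ i)
      ≤ Module.finrank k (U (c * n + c₀)) :=
        sum_finrank_le_of_le hfin fun i hi => (key i).trans (U_mono (by gcongr))
    _ ≤ Module.finrank k (Fin r → P (c * n + c₀)) := LinearMap.finrank_range_le _
    _ = r * (c * n + c₀ + 1) ^ d := by
        rw [Module.finrank_pi_fintype]
        simp [P, finrank_restrictDegree]
    _ ≤ r * ((c + c₀ + 1) * (n + 1)) ^ d := by
        gcongr
        nlinarith [Nat.zero_le (c₀ * n)]
    _ = r * (c + c₀ + 1) ^ d * (n + 1) ^ d := by rw [mul_pow, mul_assoc]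

end Growth

section HilbertFunction

variable {k R M : Type*} [Field k] [CommRing R] [Algebra k R]
  [AddCommGroup M] [Module R M] [Module k M] [IsScalarTower k R M]

/-- The Hilbert function of the submodule `N` of a graded module. -/
noncomputable def hilbertFunction (ℳ : ℕ → Submodule k M) (N : Submodule R M) (i : ℕ) : ℕ :=
  Module.finrank k ↥(N.restrictScalars k ⊓ ℳ i)

/-- The Poincaré series of the submodule `N` of a graded module, as a function of a real
variable. -/
noncomputable def poincareSeries (ℳ : ℕ → Submodule k M) (N : Submodule R M) (t : ℝ) : ℝ :=
  ∑' i, (hilbertFunction ℳ N i : ℝ) * t ^ i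

variable {ℳ : ℕ → Submodule k M}

theorem hilbertFunction_le (hfin : ∀ i, FiniteDimensional k (ℳ i)) (N : Submodule R M) (i : ℕ) :
    hilbertFunction ℳ N i ≤ Module.finrank k (ℳ i) :=
  Submodule.finrank_mono inf_le_right

theorem summable_hilbertFunction_mul_pow (hfin : ∀ i, FiniteDimensional k (ℳ i)) {t : ℝ}
    (ht : 0 ≤ t) (hsum : Summable fun i => (Module.finrank k (ℳ i) : ℝ) * t ^ i)
    (N : Submodule R M) : Summable fun i => (hilbertFunction ℳ N i : ℝ) * t ^ i :=
  hsum.of_nonneg_of_le (fun i => by positivity) fun i => by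
    gcongr
    exact hilbertFunction_le hfin N i

@[simp]
theorem hilbertFunction_top (i : ℕ) :
    hilbertFunction ℳ (⊤ : Submodule R M) i = Module.finrank k (ℳ i) := by
  rw [hilbertFunction, Submodule.restrictScalars_top, top_inf_eq]

@[simp]
theorem hilbertFunction_bot (i : ℕ) : hilbertFunction ℳ (⊥ : Submodule R M) i = 0 := by
  rw [hilbertFunction, Submodule.restrictScalars_bot, bot_inf_eq, finrank_bot]

theorem poincareSeries_top (t : ℝ) :
    poincareSeries ℳ (⊤ : Submodule R M) t = ∑' i, (Module.finrank k (ℳ i) : ℝ) * t ^ i := by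
  simp [poincareSeries]

theorem poincareSeries_bot (t : ℝ) : poincareSeries ℳ (⊥ : Submodule R M) t = 0 := by
  simp [poincareSeries]

end HilbertFunction

section HilbertSerre

variable {k R M : Type*} [Field k] [CommRing R] [Algebra k R]
  [AddCommGroup M] [Module R M] [Module k M]
  {𝒜 : ℕ → Submodule k R} {ℳ : ℕ → Submodule k M} [DirectSum.Decomposition ℳ]
  [SetLike.GradedSMul 𝒜 ℳ]

theorem gradedComponent_mem_inf_comap {x : R} {e : ℕ} (hx : x ∈ 𝒜 e) {N N' : Submodule R M}
    (hN : ∀ m ∈ N, ∀ i, gradedComponent ℳ i m ∈ N)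
    (hN' : ∀ m ∈ N', ∀ i, gradedComponent ℳ i m ∈ N') :
    ∀ m ∈ N ⊓ N'.comap (LinearMap.lsmul R M x), ∀ i,
      gradedComponent ℳ i m ∈ N ⊓ N'.comap (LinearMap.lsmul R M x) := by
  rintro m ⟨hm, hm'⟩ i
  refine ⟨hN m hm i, ?_⟩
  change x • gradedComponent ℳ i m ∈ N'
  rw [← gradedComponent_add_smul hx]
  exact hN' _ hm' _

theorem gradedComponent_mem_sup_map {x : R} {e : ℕ} (hx : x ∈ 𝒜 e) {N N' : Submodule R M}
    (hN : ∀ m ∈ N, ∀ i, gradedComponent ℳ i m ∈ N)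
    (hN' : ∀ m ∈ N', ∀ i, gradedComponent ℳ i m ∈ N') :
    ∀ m ∈ N' ⊔ N.map (LinearMap.lsmul R M x), ∀ i,
      gradedComponent ℳ i m ∈ N' ⊔ N.map (LinearMap.lsmul R M x) := by
  intro m hm i
  obtain ⟨m', hm', _, ⟨n, hn, rfl⟩, rfl⟩ := Submodule.mem_sup.mp hm
  rw [map_add]
  refine add_mem (Submodule.mem_sup_left (hN' m' hm' i)) ?_
  rw [LinearMap.lsmul_apply]
  by_cases h : e ≤ i
  · obtain ⟨j, rfl⟩ : ∃ j, i = j + e := ⟨i - e, by omega⟩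
    rw [gradedComponent_add_smul hx]
    exact Submodule.mem_sup_right ⟨_, hN n hn j, rfl⟩
  · rw [gradedComponent_smul_of_lt hx (by omega)]
    exact zero_mem _

variable [IsScalarTower k R M]

theorem hilbertFunction_sup_map_of_lt {x : R} {e : ℕ} (hx : x ∈ 𝒜 e) {N N' : Submodule R M}
    (hN' : ∀ m ∈ N', ∀ i, gradedComponent ℳ i m ∈ N') {i : ℕ} (hi : i < e) :
    hilbertFunction ℳ (N' ⊔ N.map (LinearMap.lsmul R M x)) i = hilbertFunction ℳ N' i := by
  suffices h : (N' ⊔ N.map (LinearMap.lsmul R M x)).restrictScalars k ⊓ ℳ i =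
      N'.restrictScalars k ⊓ ℳ i by rw [hilbertFunction, h, hilbertFunction]
  refine le_antisymm ?_ (inf_le_inf_right _ fun m hm => Submodule.mem_sup_left hm)
  rintro m ⟨hm, hmi⟩
  refine ⟨?_, hmi⟩
  obtain ⟨m', hm', _, ⟨n, -, rfl⟩, rfl⟩ := Submodule.mem_sup.mp hm
  rw [← gradedComponent_of_mem hmi, map_add, LinearMap.lsmul_apply,
    gradedComponent_smul_of_lt hx hi, add_zero]
  exact hN' m' hm' i

theorem hilbertFunction_add_hilbertFunction (hfin : ∀ i, FiniteDimensional k (ℳ i)) {x : R}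
    {e : ℕ} (hx : x ∈ 𝒜 e) {N N' : Submodule R M}
    (hN : ∀ m ∈ N, ∀ i, gradedComponent ℳ i m ∈ N)
    (hN' : ∀ m ∈ N', ∀ i, gradedComponent ℳ i m ∈ N') (i : ℕ) :
    hilbertFunction ℳ N i + hilbertFunction ℳ N' (i + e) =
      hilbertFunction ℳ (N ⊓ N'.comap (LinearMap.lsmul R M x)) i +
        hilbertFunction ℳ (N' ⊔ N.map (LinearMap.lsmul R M x)) (i + e) := by
  unfold hilbertFunction
  set A := N.restrictScalars k ⊓ ℳ i
  set B := N'.restrictScalars k ⊓ ℳ (i + e)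
  set C := (N ⊓ N'.comap (LinearMap.lsmul R M x)).restrictScalars k ⊓ ℳ i
  set E := (N' ⊔ N.map (LinearMap.lsmul R M x)).restrictScalars k ⊓ ℳ (i + e)
  have smul_mem : ∀ m ∈ ℳ i, x • m ∈ ℳ (i + e) := fun m hm => by
    have h : x • m ∈ ℳ (e + i) := SetLike.GradedSMul.smul_mem hx hm
    rwa [add_comm]
  let μ : M →ₗ[k] M := (LinearMap.lsmul R M x).restrictScalars k
  let f : A × B →ₗ[k] M := LinearMap.coprod (μ ∘ₗ A.subtype) B.subtype
  have hf : ∀ v, f v = x • (v.1 : M) + (v.2 : M) := fun v => by simp [f, μ]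
  have hA : FiniteDimensional k A := Submodule.finiteDimensional_of_le inf_le_right
  have hB : FiniteDimensional k B := Submodule.finiteDimensional_of_le inf_le_right
  have hC : FiniteDimensional k C := Submodule.finiteDimensional_of_le inf_le_right
  have hrange : LinearMap.range f = E := by
    apply le_antisymm
    · rintro _ ⟨⟨⟨a, ha, hai⟩, ⟨b, hb, hbi⟩⟩, rfl⟩
      rw [hf]
      exact ⟨add_mem (Submodule.mem_sup_right ⟨a, ha, rfl⟩) (Submodule.mem_sup_left hb),
        add_mem (smul_mem a hai) hbi⟩
    · rintro m ⟨hm, hmi⟩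
      obtain ⟨b, hb, _, ⟨a, ha, rfl⟩, rfl⟩ := Submodule.mem_sup.mp hm
      refine ⟨⟨⟨gradedComponent ℳ i a, hN a ha i, gradedComponent_mem _ _⟩,
        ⟨gradedComponent ℳ (i + e) b, hN' b hb _, gradedComponent_mem _ _⟩⟩, ?_⟩
      rw [hf]
      change x • gradedComponent ℳ i a + gradedComponent ℳ (i + e) b = _
      rw [← gradedComponent_add_smul hx, ← map_add, add_comm (x • a)]
      exact gradedComponent_of_mem hmi
  have hker : Module.finrank k (LinearMap.ker f) = Module.finrank k C := by
    let g : C →ₗ[k] A × B := LinearMap.prod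
      (Submodule.inclusion fun m hm => ⟨hm.1.1, hm.2⟩)
      ((-(μ ∘ₗ C.subtype)).codRestrict B fun m =>
        ⟨neg_mem m.2.1.2, neg_mem (smul_mem m m.2.2)⟩)
    have hg : Function.Injective g := fun m n h =>
      Subtype.ext (congrArg (fun v : A × B => (v.1 : M)) h)
    suffices h : LinearMap.ker f = LinearMap.range g by
      rw [h, LinearMap.finrank_range_of_inj hg]
    apply le_antisymm
    · rintro ⟨a, b⟩ hab
      have hab' : x • (a : M) + (b : M) = 0 := by rw [← hf (a, b)]; exact hab
      have hb : (b : M) = -(x • (a : M)) := (neg_eq_of_add_eq_zero_right hab').symm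
      refine ⟨⟨a, ⟨a.2.1, ?_⟩, a.2.2⟩, Prod.ext rfl (Subtype.ext hb.symm)⟩
      change x • (a : M) ∈ N'
      rw [← neg_neg (x • (a : M)), ← hb]
      exact neg_mem b.2.1
    · rintro _ ⟨m, rfl⟩
      change f (g m) = 0
      rw [hf]
      exact add_neg_cancel (x • (m : M))
  have := LinearMap.finrank_range_add_finrank_ker f
  rw [hrange, hker, Module.finrank_prod] at this
  omega

theorem pow_mul_poincareSeries_add (hfin : ∀ i, FiniteDimensional k (ℳ i)) {x : R}
    {e : ℕ} (hx : x ∈ 𝒜 e) {N N' : Submodule R M}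
    (hN : ∀ m ∈ N, ∀ i, gradedComponent ℳ i m ∈ N)
    (hN' : ∀ m ∈ N', ∀ i, gradedComponent ℳ i m ∈ N') {t : ℝ} (ht : 0 ≤ t)
    (hsum : Summable fun i => (Module.finrank k (ℳ i) : ℝ) * t ^ i) :
    t ^ e * poincareSeries ℳ N t + poincareSeries ℳ N' t =
      t ^ e * poincareSeries ℳ (N ⊓ N'.comap (LinearMap.lsmul R M x)) t +
        poincareSeries ℳ (N' ⊔ N.map (LinearMap.lsmul R M x)) t := by
  set K := N ⊓ N'.comap (LinearMap.lsmul R M x)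
  set Q := N' ⊔ N.map (LinearMap.lsmul R M x)
  have S := fun N : Submodule R M => summable_hilbertFunction_mul_pow hfin ht hsum N
  have S' := fun N : Submodule R M => (summable_nat_add_iff e).mpr (S N)
  unfold poincareSeries
  rw [← (S N').sum_add_tsum_nat_add e, ← (S Q).sum_add_tsum_nat_add e, ← tsum_mul_left,
    ← tsum_mul_left]
  have hlow : ∑ i ∈ Finset.range e, (hilbertFunction ℳ Q i : ℝ) * t ^ i =
      ∑ i ∈ Finset.range e, (hilbertFunction ℳ N' i : ℝ) * t ^ i :=
    Finset.sum_congr rfl fun i hi => by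
      rw [hilbertFunction_sup_map_of_lt hx hN' (Finset.mem_range.mp hi)]
  have hhigh := congrArg tsum (funext fun i => show
      t ^ e * ((hilbertFunction ℳ N i : ℝ) * t ^ i) +
        (hilbertFunction ℳ N' (i + e) : ℝ) * t ^ (i + e) =
      t ^ e * ((hilbertFunction ℳ K i : ℝ) * t ^ i) +
        (hilbertFunction ℳ Q (i + e) : ℝ) * t ^ (i + e) by
    have h : (hilbertFunction ℳ N i : ℝ) + hilbertFunction ℳ N' (i + e) =
        hilbertFunction ℳ K i + hilbertFunction ℳ Q (i + e) := by
      exact_mod_cast hilbertFunction_add_hilbertFunction hfin hx hN hN' i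
    rw [pow_add]
    linear_combination t ^ i * t ^ e * h)
  rw [((S N).mul_left _).tsum_add (S' N'), ((S K).mul_left _).tsum_add (S' Q)] at hhigh
  rw [hlow]
  linarith

/-- The **Hilbert–Serre theorem** for graded subquotients `N / N'` of a graded module. -/
theorem exists_polynomial_eq_prod_mul_poincareSeries [GradedAlgebra 𝒜] [IsNoetherian R M]
    (hfin : ∀ i, FiniteDimensional k (ℳ i))
    (hsum : ∀ t ∈ Set.Ico (0 : ℝ) 1, Summable fun i => (Module.finrank k (ℳ i) : ℝ) * t ^ i)
    {s : Finset R} {e : R → ℕ} (hs : ∀ x ∈ s, x ∈ 𝒜 (e x))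
    (hspan : ∀ n, 0 < n → ∀ a ∈ 𝒜 n, a ∈ Ideal.span (s : Set R))
    {T : Finset R} (hT : T ⊆ s) {N N' : Submodule R M} (hle : N' ≤ N)
    (hN : ∀ m ∈ N, ∀ i, gradedComponent ℳ i m ∈ N)
    (hN' : ∀ m ∈ N', ∀ i, gradedComponent ℳ i m ∈ N')
    (hkill : ∀ x ∈ s, x ∉ T → ∀ m ∈ N, x • m ∈ N') :
    ∃ p : Polynomial ℚ, ∀ t ∈ Set.Ico (0 : ℝ) 1,
      (∏ x ∈ T, (1 - t ^ e x)) * (poincareSeries ℳ N t - poincareSeries ℳ N' t) =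
        Polynomial.aeval t p := by
  classical
  induction T using Finset.induction_on generalizing N N' with
  | empty =>
    have hsN : Ideal.span (s : Set R) • N ≤ N' := by
      refine Submodule.smul_le.mpr fun a ha m hm => ?_
      obtain ⟨f, -, rfl⟩ := Submodule.mem_span_finset.mp ha
      rw [Finset.sum_smul]
      refine sum_mem fun x hx => ?_
      rw [smul_eq_mul, mul_smul]
      exact N'.smul_mem _ (hkill x hx (by simp) m hm)
    obtain ⟨D, hD⟩ := exists_mem_span_smul_of_lt_degree hspan hN
    have heq : ∀ i, D < i → hilbertFunction ℳ N i = hilbertFunction ℳ N' i := by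
      intro i hi
      have h : N.restrictScalars k ⊓ ℳ i = N'.restrictScalars k ⊓ ℳ i :=
        le_antisymm (fun m hm => ⟨hsN (hD i hi m hm.1 hm.2), hm.2⟩) (inf_le_inf_right _ hle)
      rw [hilbertFunction, h, hilbertFunction]
    refine ⟨∑ i ∈ Finset.range (D + 1), Polynomial.C ((hilbertFunction ℳ N i : ℚ) -
      hilbertFunction ℳ N' i) * Polynomial.X ^ i, fun t ht => ?_⟩
    have S := fun N : Submodule R M =>
      summable_hilbertFunction_mul_pow hfin ht.1 (hsum t ht) N
    rw [Finset.prod_empty, one_mul, poincareSeries, poincareSeries, ← (S N).tsum_sub (S N'),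
      tsum_eq_sum (s := Finset.range (D + 1))]
    · simp [sub_mul]
    · intro i hi
      rw [heq i (by simpa using hi), sub_self]
  | insert x T hx ih =>
    have hxs := hs x (hT (Finset.mem_insert_self x T))
    have hT' := (Finset.subset_insert x T).trans hT
    obtain ⟨p₁, h₁⟩ := ih hT'
      (N := N) (N' := N' ⊔ N.map (LinearMap.lsmul R M x))
      (sup_le hle (Submodule.map_le_iff_le_comap.mpr fun m hm => N.smul_mem x hm)) hN
      (gradedComponent_mem_sup_map hxs hN hN') (fun y hy hyT m hm => by
        by_cases hyx : y = x
        · subst hyx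
          exact Submodule.mem_sup_right ⟨m, hm, rfl⟩
        · exact Submodule.mem_sup_left (hkill y hy (by simp [hyx, hyT]) m hm))
    obtain ⟨p₂, h₂⟩ := ih hT'
      (N := N ⊓ N'.comap (LinearMap.lsmul R M x)) (N' := N')
      (le_inf hle fun m hm => N'.smul_mem x hm)
      (gradedComponent_mem_inf_comap hxs hN hN') hN' (fun y hy hyT m hm => by
        by_cases hyx : y = x
        · subst hyx
          exact hm.2
        · exact hkill y hy (by simp [hyx, hyT]) m hm.1)
    refine ⟨p₁ - Polynomial.X ^ e x * p₂, fun t ht => ?_⟩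
    rw [Finset.prod_insert hx, map_sub, map_mul, map_pow, Polynomial.aeval_X, ← h₁ t ht,
      ← h₂ t ht]
    have h := pow_mul_poincareSeries_add hfin hxs hN hN' ht.1 (hsum t ht)
    linear_combination (-∏ x ∈ T, (1 - t ^ e x)) * h

end HilbertSerre

section PoleOrder

theorem pow_le_factorial_mul_choose (n d : ℕ) : (n + 1) ^ d ≤ d.factorial * (n + d).choose d :=
  (Nat.pow_succ_le_ascFactorial (n + 1) d).trans_eq (Nat.ascFactorial_eq_factorial_mul_choose n d)

theorem choose_le_succ_pow (n d : ℕ) : (n + d).choose d ≤ (n + 1) ^ d := by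
  induction d with
  | zero => simp
  | succ d ih =>
    have h := Nat.add_one_mul_choose_eq (n + d) d
    have : (n + d + 1).choose (d + 1) ≤ (n + 1) * (n + d).choose d := by
      refine Nat.le_of_mul_le_mul_right (c := d + 1) (h ▸ ?_) (by omega)
      have : n + d + 1 ≤ (n + 1) * (d + 1) := by nlinarith [Nat.zero_le (n * d)]
      calc (n + d + 1) * (n + d).choose d ≤ ((n + 1) * (d + 1)) * (n + d).choose d := by gcongr
        _ = _ := by ring
    calc _ ≤ (n + 1) * (n + d).choose d := this
      _ ≤ (n + 1) * (n + 1) ^ d := by gcongr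
      _ = _ := (pow_succ' _ _).symm

variable {h : ℕ → ℕ} {d K : ℕ}

theorem summable_sum_range_mul_pow
    (hK : ∀ n, ∑ i ∈ Finset.range (n + 1), h i ≤ K * (n + 1) ^ d) {t : ℝ}
    (ht : t ∈ Set.Ico (0 : ℝ) 1) :
    Summable (fun n => ((∑ i ∈ Finset.range (n + 1), h i : ℕ) : ℝ) * t ^ n) ∧
      ∑' n, ((∑ i ∈ Finset.range (n + 1), h i : ℕ) : ℝ) * t ^ n ≤
        (K * d.factorial : ℝ) / (1 - t) ^ (d + 1) := by
  have hnorm : ‖t‖ < 1 := by rw [Real.norm_of_nonneg ht.1]; exact ht.2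
  have hsum := (hasSum_choose_mul_geometric_of_norm_lt_one d hnorm).mul_left
    (K * d.factorial : ℝ)
  have hle : ∀ n, ((∑ i ∈ Finset.range (n + 1), h i : ℕ) : ℝ) * t ^ n ≤
      (K * d.factorial : ℝ) * ((n + d).choose d * t ^ n) := by
    intro n
    have h1 : ∑ i ∈ Finset.range (n + 1), h i ≤ K * (d.factorial * (n + d).choose d) :=
      (hK n).trans (Nat.mul_le_mul_left _ (pow_le_factorial_mul_choose n d))
    have h2 : ((∑ i ∈ Finset.range (n + 1), h i : ℕ) : ℝ) ≤
      K * (d.factorial * (n + d).choose d) := by exact_mod_cast h1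
    have := mul_le_mul_of_nonneg_right h2 (pow_nonneg ht.1 n)
    linarith
  have hS := hsum.summable.of_nonneg_of_le
    (fun n => mul_nonneg (Nat.cast_nonneg _) (pow_nonneg ht.1 n)) hle
  refine ⟨hS, (hS.tsum_le_tsum hle hsum.summable).trans_eq ?_⟩
  rw [hsum.tsum_eq, mul_one_div]

theorem summable_mul_pow (hK : ∀ n, ∑ i ∈ Finset.range (n + 1), h i ≤ K * (n + 1) ^ d) {t : ℝ}
    (ht : t ∈ Set.Ico (0 : ℝ) 1) : Summable fun n => (h n : ℝ) * t ^ n :=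
  (summable_sum_range_mul_pow hK ht).1.of_nonneg_of_le
    (fun n => mul_nonneg (Nat.cast_nonneg _) (pow_nonneg ht.1 n)) fun n => by
      have := ht.1
      gcongr
      exact Finset.single_le_sum (f := h) (fun _ _ => Nat.zero_le _) (by simp)

theorem tsum_mul_pow_eq (hK : ∀ n, ∑ i ∈ Finset.range (n + 1), h i ≤ K * (n + 1) ^ d) {t : ℝ}
    (ht : t ∈ Set.Ico (0 : ℝ) 1) :
    ∑' n, (h n : ℝ) * t ^ n =
      (1 - t) * ∑' n, ((∑ i ∈ Finset.range (n + 1), h i : ℕ) : ℝ) * t ^ n := by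
  have hS := (summable_sum_range_mul_pow hK ht).1
  have hS' := (summable_nat_add_iff 1).mpr hS
  have hzero := hS.tsum_eq_zero_add
  have hshift := hS'.tsum_sub (hS.mul_left t)
  rw [tsum_mul_left] at hshift
  have hstep : ∀ n, ((∑ i ∈ Finset.range (n + 1 + 1), h i : ℕ) : ℝ) * t ^ (n + 1) -
      t * (((∑ i ∈ Finset.range (n + 1), h i : ℕ) : ℝ) * t ^ n) = h (n + 1) * t ^ (n + 1) := by
    intro n
    rw [Finset.sum_range_succ _ (n + 1)]
    push_cast
    ring
  rw [tsum_congr hstep] at hshift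
  rw [(summable_mul_pow hK ht).tsum_eq_zero_add, hshift, sub_mul, one_mul, hzero]
  simp only [zero_add, Finset.sum_range_one]
  linarith

theorem one_sub_pow_mul_tsum_le
    (hK : ∀ n, ∑ i ∈ Finset.range (n + 1), h i ≤ K * (n + 1) ^ d) {t : ℝ}
    (ht : t ∈ Set.Ico (0 : ℝ) 1) :
    (1 - t) ^ d * ∑' n, (h n : ℝ) * t ^ n ≤ K * d.factorial := by
  have h1 : 0 < 1 - t := sub_pos.mpr ht.2
  rw [tsum_mul_pow_eq hK ht, ← mul_assoc, ← pow_succ]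
  calc _ ≤ (1 - t) ^ (d + 1) * ((K * d.factorial : ℝ) / (1 - t) ^ (d + 1)) := by
        gcongr
        exact (summable_sum_range_mul_pow hK ht).2
    _ = _ := by field_simp

theorem le_one_sub_pow_mul_tsum
    (hK : ∀ n, ∑ i ∈ Finset.range (n + 1), h i ≤ K * (n + 1) ^ d) {a b : ℕ} (ha : 0 < a)
    (hab : ∀ n, (n + 1) ^ d ≤ ∑ i ∈ Finset.range (a * n + b + 1), h i) {t : ℝ}
    (ht : t ∈ Set.Ico (0 : ℝ) 1) :
    t ^ b / (a : ℝ) ^ (d + 1) ≤ (1 - t) ^ d * ∑' n, (h n : ℝ) * t ^ n := by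
  have h1 : 0 < 1 - t := sub_pos.mpr ht.2
  have hta : t ^ a < 1 := pow_lt_one₀ ht.1 ht.2 ha.ne'
  have hbern : 1 - t ^ a ≤ a * (1 - t) := by
    have := one_add_mul_sub_le_pow (a := t) (by linarith [ht.1]) a
    linarith
  have hS := (summable_sum_range_mul_pow hK ht).1
  have hnorm : ‖t ^ a‖ < 1 := by rwa [Real.norm_of_nonneg (pow_nonneg ht.1 a)]
  have hsum := (hasSum_choose_mul_geometric_of_norm_lt_one d hnorm).mul_left (t ^ b)
  have hinj : Function.Injective fun n => a * n + b := fun n m hnm =>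
    Nat.eq_of_mul_eq_mul_left ha (Nat.add_right_cancel hnm)
  have hle : t ^ b * (1 / (1 - t ^ a) ^ (d + 1)) ≤
      ∑' n, ((∑ i ∈ Finset.range (n + 1), h i : ℕ) : ℝ) * t ^ n := by
    rw [← hsum.tsum_eq]
    refine hsum.summable.tsum_le_tsum_of_inj (fun n => a * n + b) hinj
      (fun n _ => mul_nonneg (Nat.cast_nonneg _) (pow_nonneg ht.1 n)) (fun n => ?_) hS
    have h2 : ((n + d).choose d : ℝ) ≤ ((∑ i ∈ Finset.range (a * n + b + 1), h i : ℕ) : ℝ) := by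
      exact_mod_cast (choose_le_succ_pow n d).trans (hab n)
    have := mul_le_mul_of_nonneg_right h2 (pow_nonneg ht.1 (a * n + b))
    calc _ = ((n + d).choose d : ℝ) * t ^ (a * n + b) := by rw [pow_add, pow_mul]; ring
      _ ≤ _ := this
  rw [tsum_mul_pow_eq hK ht, ← mul_assoc, ← pow_succ]
  have hpos : (0 : ℝ) < 1 - t ^ a := by linarith
  calc t ^ b / (a : ℝ) ^ (d + 1)
      = (1 - t) ^ (d + 1) * (t ^ b * (1 / (a * (1 - t)) ^ (d + 1))) := by
        rw [mul_pow]; field_simp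
    _ ≤ (1 - t) ^ (d + 1) * (t ^ b * (1 / (1 - t ^ a) ^ (d + 1))) := by
        have := ht.1
        gcongr
    _ ≤ _ := by gcongr

open Filter Topology in
theorem exists_rat_tendsto_of_prod_mul_eq_polynomial {ι : Type*} {s : Finset ι} {e : ι → ℕ}
    (he : ∀ x ∈ s, 0 < e x) {p : Polynomial ℚ} {F : ℝ → ℝ}
    (hp : ∀ t ∈ Set.Ico (0 : ℝ) 1, (∏ x ∈ s, (1 - t ^ e x)) * F t = Polynomial.aeval t p)
    {c C : ℝ} (hc : 0 < c) (hlow : ∀ t ∈ Set.Ico (1 / 2 : ℝ) 1, c ≤ (1 - t) ^ d * F t)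
    (hup : ∀ t ∈ Set.Ico (1 / 2 : ℝ) 1, (1 - t) ^ d * F t ≤ C) :
    ∃ q : ℚ, 0 < q ∧
      Tendsto (fun t : ℝ => (1 - t) ^ d * F t) (𝓝[Set.Ico (0 : ℝ) 1] 1) (𝓝 (q : ℝ)) := by
  have hne : (𝓝[Set.Ico (0 : ℝ) 1] (1 : ℝ)).NeBot := by
    rw [← mem_closure_iff_nhdsWithin_neBot, closure_Ico zero_ne_one]
    simp
  have hev : ∀ᶠ t in 𝓝[Set.Ico (0 : ℝ) 1] (1 : ℝ), t ∈ Set.Ico (1 / 2 : ℝ) 1 := by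
    filter_upwards [self_mem_nhdsWithin,
      mem_nhdsWithin_of_mem_nhds (Ioi_mem_nhds (by norm_num : (1 / 2 : ℝ) < 1))] with t h1 h2
    exact ⟨le_of_lt h2, h1.2⟩
  have hev0 : ∀ t ∈ Set.Ico (1 / 2 : ℝ) 1, t ∈ Set.Ico (0 : ℝ) 1 :=
    fun t ht => ⟨by linarith [ht.1], ht.2⟩
  have hp0 : p ≠ 0 := by
    rintro rfl
    have hhalf : (1 / 2 : ℝ) ∈ Set.Ico (1 / 2 : ℝ) 1 := by norm_num
    have h1 := hp _ (hev0 _ hhalf)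
    rw [map_zero, mul_eq_zero] at h1
    rcases h1 with h1 | h1
    · obtain ⟨x, hx, hx0⟩ := Finset.prod_eq_zero_iff.mp h1
      have := pow_lt_one₀ (by norm_num : (0 : ℝ) ≤ 1 / 2) (by norm_num) (he x hx).ne'
      linarith
    · have := hlow _ hhalf
      rw [h1, mul_zero] at this
      linarith
  obtain ⟨p₁, hp₁, hndvd⟩ := p.exists_eq_pow_rootMultiplicity_mul_and_not_dvd hp0 1
  set m := p.rootMultiplicity 1
  rw [Polynomial.dvd_iff_isRoot, Polynomial.IsRoot] at hndvd
  let Q : Polynomial ℚ := (-1) ^ m * p₁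
  have hQ1 : Q.eval 1 ≠ 0 := by simpa [Q] using hndvd
  let G : Polynomial ℚ := ∏ x ∈ s, ∑ i ∈ Finset.range (e x), Polynomial.X ^ i
  have hG1 : 0 < G.eval 1 := by
    simp only [G, Polynomial.eval_prod]
    refine Finset.prod_pos fun x hx => ?_
    simpa [Polynomial.eval_finsetSum] using he x hx
  have hGt : ∀ t : ℝ, 0 < t → 0 < Polynomial.aeval t G := by
    intro t ht
    simp only [G, map_prod, map_sum, map_pow, Polynomial.aeval_X]
    exact Finset.prod_pos fun x hx => Finset.sum_pos (fun i _ => by positivity)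
      ⟨0, by simpa using he x hx⟩
  have aeval_one : ∀ P : Polynomial ℚ, Polynomial.aeval (1 : ℝ) P = ((P.eval 1 : ℚ) : ℝ) := by
    intro P
    have := Polynomial.aeval_algebraMap_apply ℝ (1 : ℚ) P
    simpa using this
  have hlim : Tendsto (fun t : ℝ => Polynomial.aeval t Q / Polynomial.aeval t G)
      (𝓝[Set.Ico (0 : ℝ) 1] 1) (𝓝 ((Q.eval 1 / G.eval 1 : ℚ) : ℝ)) := by
    have hcont : ContinuousAt (fun t : ℝ => Polynomial.aeval t Q / Polynomial.aeval t G) 1 :=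
      (Polynomial.continuous_aeval Q).continuousAt.div
        (Polynomial.continuous_aeval G).continuousAt (hGt 1 one_pos).ne'
    have := hcont.tendsto.mono_left (nhdsWithin_le_nhds (s := Set.Ico (0 : ℝ) 1))
    rwa [aeval_one, aeval_one, ← Rat.cast_div] at this
  have hsub : Tendsto (fun t : ℝ => 1 - t) (𝓝[Set.Ico (0 : ℝ) 1] 1) (𝓝 0) := by
    have : ContinuousAt (fun t : ℝ => 1 - t) 1 := by fun_prop
    simpa using this.tendsto.mono_left (nhdsWithin_le_nhds (s := Set.Ico (0 : ℝ) 1))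
  have hkey : ∀ t ∈ Set.Ico (1 / 2 : ℝ) 1,
      (1 - t) ^ s.card * ((1 - t) ^ d * F t) =
        (1 - t) ^ (m + d) * (Polynomial.aeval t Q / Polynomial.aeval t G) := by
    intro t ht
    have h1 := hp t (hev0 t ht)
    have h2 : ∏ x ∈ s, (1 - t ^ e x) = (1 - t) ^ s.card * Polynomial.aeval t G := by
      simp only [G, map_prod, map_sum, map_pow, Polynomial.aeval_X]
      rw [← Finset.prod_const, ← Finset.prod_mul_distrib]
      exact Finset.prod_congr rfl fun x _ => (mul_neg_geom_sum t (e x)).symm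
    have h3 : Polynomial.aeval t p = (1 - t) ^ m * Polynomial.aeval t Q := by
      rw [hp₁]
      simp only [Q, map_mul, map_pow, map_sub, map_neg, map_one, Polynomial.aeval_X]
      rw [← mul_assoc, ← mul_pow]
      simp
    rw [h2, h3] at h1
    have hG := hGt t (by linarith [ht.1])
    rw [pow_add]
    field_simp
    linear_combination (1 - t) ^ d * h1
  rcases lt_trichotomy (m + d) s.card with hlt | heq | hgt
  · obtain ⟨j, hj⟩ := Nat.exists_eq_add_of_lt hlt
    have heq' : (fun t : ℝ => (1 - t) ^ (j + 1) * ((1 - t) ^ d * F t)) =ᶠ[𝓝[Set.Ico (0 : ℝ) 1] 1]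
        fun t => Polynomial.aeval t Q / Polynomial.aeval t G := by
      filter_upwards [hev] with t ht
      have h1 : 0 < 1 - t := sub_pos.mpr ht.2
      have := hkey t ht
      rw [hj, add_assoc, pow_add, mul_assoc] at this
      exact mul_left_cancel₀ (pow_pos h1 _).ne' this
    have h0 : Tendsto (fun t : ℝ => (1 - t) ^ (j + 1) * ((1 - t) ^ d * F t))
        (𝓝[Set.Ico (0 : ℝ) 1] 1) (𝓝 0) := by
      have hu : Tendsto (fun t : ℝ => (1 - t) ^ (j + 1) * C) (𝓝[Set.Ico (0 : ℝ) 1] 1) (𝓝 0) := by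
        simpa using (hsub.pow (j + 1)).mul_const C
      refine tendsto_of_tendsto_of_tendsto_of_le_of_le' tendsto_const_nhds hu ?_ ?_
      · filter_upwards [hev] with t ht
        have h1 : 0 < 1 - t := sub_pos.mpr ht.2
        exact mul_nonneg (pow_pos h1 _).le (hc.le.trans (hlow t ht))
      · filter_upwards [hev] with t ht
        have h1 : 0 < 1 - t := sub_pos.mpr ht.2
        exact mul_le_mul_of_nonneg_left (hup t ht) (pow_pos h1 _).le
    have := tendsto_nhds_unique h0 (hlim.congr' heq'.symm)
    exact absurd this.symm (by exact_mod_cast div_ne_zero hQ1 hG1.ne')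
  · have heq' : (fun t : ℝ => (1 - t) ^ d * F t) =ᶠ[𝓝[Set.Ico (0 : ℝ) 1] 1]
        fun t => Polynomial.aeval t Q / Polynomial.aeval t G := by
      filter_upwards [hev] with t ht
      have h1 : 0 < 1 - t := sub_pos.mpr ht.2
      have := hkey t ht
      rw [heq] at this
      exact mul_left_cancel₀ (pow_pos h1 _).ne' this
    have hlim' := hlim.congr' heq'.symm
    refine ⟨_, ?_, hlim'⟩
    have : c ≤ ((Q.eval 1 / G.eval 1 : ℚ) : ℝ) :=
      ge_of_tendsto hlim' (hev.mono fun t ht => hlow t ht)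
    exact_mod_cast hc.trans_le this
  · obtain ⟨j, hj⟩ := Nat.exists_eq_add_of_lt hgt
    have heq' : (fun t : ℝ => (1 - t) ^ d * F t) =ᶠ[𝓝[Set.Ico (0 : ℝ) 1] 1]
        fun t => (1 - t) ^ (j + 1) * (Polynomial.aeval t Q / Polynomial.aeval t G) := by
      filter_upwards [hev] with t ht
      have h1 : 0 < 1 - t := sub_pos.mpr ht.2
      have := hkey t ht
      rw [hj, add_assoc s.card, pow_add, mul_assoc] at this
      exact mul_left_cancel₀ (pow_pos h1 _).ne' this
    have hlim' := ((hsub.pow (j + 1)).mul hlim).congr' heq'.symm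
    rw [zero_pow j.succ_ne_zero, zero_mul] at hlim'
    exact absurd (ge_of_tendsto hlim' (hev.mono fun t ht => hlow t ht)) (not_le.mpr hc)

end PoleOrder

/-- Let `R` be a commutative ℕ-graded Noetherian ring with `R₀` a
finite-dimensional algebra over a field `k` (a ring of "type I"), and let `M` be a nonzero
finitely generated graded `R`-module, with grading `ℳ` (each component a finite-dimensional
`k`-vector space).  If the Krull dimension of `R/Ann_R(M)` equals the natural number `d`,
then there is a positive rational number `q` (the degree of `M`) such that
`(1 - t)^d · P_M(t) → q` as `t → 1⁻` (for real `t`, `0 ≤ t < 1`), where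
`P_M(t) = Σ_i dim_k(M_i) tⁱ` is the Poincaré series of `M`. -/
theorem stmt9 {k R M : Type*} [Field k] [CommRing R] [Algebra k R] [IsNoetherianRing R]
    (𝒜 : ℕ → Submodule k R) [GradedAlgebra 𝒜] [FiniteDimensional k (𝒜 0)]
    [AddCommGroup M] [Module R M] [Module k M] [IsScalarTower k R M]
    [Module.Finite R M] [Nontrivial M]
    (ℳ : ℕ → Submodule k M) [DirectSum.Decomposition ℳ] [SetLike.GradedSMul 𝒜 ℳ]
    (hfin : ∀ i, FiniteDimensional k (ℳ i))
    (d : ℕ) (hdim : ringKrullDim (R ⧸ Module.annihilator R M) = d) :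
    ∃ q : ℚ, 0 < q ∧
      Filter.Tendsto
        (fun t : ℝ => (1 - t) ^ d * ∑' i : ℕ, (Module.finrank k (ℳ i) : ℝ) * t ^ i)
        (nhdsWithin 1 (Set.Ico (0 : ℝ) 1)) (nhds (q : ℝ)) := by
  obtain ⟨s, e, hs, hspan⟩ := exists_finset_homogeneous_span 𝒜
  have := finiteType_of_graded hs hspan
  have := isNoetherian_of_isNoetherianRing_of_finite R M
  obtain ⟨φ, hφ, r, g, hg⟩ :=
    exists_mvPolynomial_algHom_faithful_finite (k := k) (R := R) (M := M) d hdim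
  obtain ⟨a, b, ha, hab⟩ := exists_pow_le_sum_finrank 𝒜 hfin hφ hg
  obtain ⟨K, hK⟩ := exists_sum_finrank_le_pow hfin hs hspan hg
  obtain ⟨p, hp⟩ := exists_polynomial_eq_prod_mul_poincareSeries hfin
    (fun t ht => summable_mul_pow hK ht) (fun x hx => (hs x hx).2) hspan subset_rfl
    (N := (⊤ : Submodule R M)) (N' := ⊥) bot_le (fun _ _ _ => trivial)
    (fun m hm i => by rw [(Submodule.mem_bot R).mp hm, map_zero]; exact zero_mem _)
    (fun x hx hxs => absurd hx hxs)
  simp only [poincareSeries_top, poincareSeries_bot, sub_zero] at hp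
  have ha' : (0 : ℝ) < a := Nat.cast_pos.mpr ha
  refine exists_rat_tendsto_of_prod_mul_eq_polynomial (fun x hx => (hs x hx).1) hp
    (c := (1 / 2) ^ b / (a : ℝ) ^ (d + 1)) (by positivity) (fun t ht => ?_) (fun t ht =>
      one_sub_pow_mul_tsum_le hK ⟨by linarith [ht.1], ht.2⟩)
  refine le_trans ?_ (le_one_sub_pow_mul_tsum hK ha hab ⟨by linarith [ht.1], ht.2⟩)
  have := ht.1
  gcongr
end

section
/- Suppose the Krull dimension of R/Ann_R(M) equals the natural number d, that (1 − t)^d · P_M(t) → δ as t → 1⁻ for some real number δ, and that for each p ∈ D(M) there is a real number δ_p with (1 − t)^d · P_{R/p}(t) → δ_p as t → 1⁻. Then for each p ∈ D(M) the localized module M_p has finite length over R_p, and δ = Σ_{p ∈ D(M)} ℓ_{R_p}(M_p) · δ_p. -/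
section GradedHilbert

open DirectSum Module

variable {k R M : Type*} [Field k] [CommRing R] [Algebra k R]
  (𝒜 : ℕ → Submodule k R) [GradedAlgebra 𝒜]
  [AddCommGroup M] [Module R M] [Module k M] [IsScalarTower k R M]
  (ℳ : ℕ → Submodule k M) [DirectSum.Decomposition ℳ] [SetLike.GradedSMul 𝒜 ℳ]

omit [IsScalarTower k R M] in
lemma coe_decompose_smul_of_mem (r : R) {m : M} {s : ℕ} (hm : m ∈ ℳ s) (i : ℕ) :
    (decompose ℳ (r • m) i : M) =
      if s ≤ i then (decompose 𝒜 r (i - s) : R) • m else 0 := by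
  induction r using Decomposition.inductionOn 𝒜 with
  | zero => simp
  | add a b ha hb =>
    rw [add_smul, decompose_add, decompose_add, DirectSum.add_apply, DirectSum.add_apply,
      Submodule.coe_add, Submodule.coe_add, ha, hb]
    split_ifs
    · rw [add_smul]
    · simp
  | homogeneous a =>
    rename_i j
    have ham : (a : R) • m ∈ ℳ (j + s) := SetLike.GradedSMul.smul_mem a.2 hm
    by_cases h : j + s = i
    · subst h
      rw [decompose_of_mem_same _ ham, if_pos (Nat.le_add_left s j), Nat.add_sub_cancel,
        decompose_of_mem_same 𝒜 a.2]
    · rw [decompose_of_mem_ne _ ham h]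
      split_ifs with hs
      · rw [decompose_of_mem_ne 𝒜 a.2 (by omega), zero_smul]
      · rfl

/-- The image of the `i`-th graded component of `M` in `M ⧸ N`. -/
def gradedImage (N : Submodule R M) (i : ℕ) : Submodule k (M ⧸ N) :=
  (ℳ i).map (N.mkQ.restrictScalars k)

include 𝒜 in
omit [IsScalarTower k R M] in
lemma Submodule.IsHomogeneous.sup_span_singleton {N : Submodule R M} (hN : N.IsHomogeneous ℳ)
    {m : M} {s : ℕ} (hm : m ∈ ℳ s) : (N ⊔ Submodule.span R {m}).IsHomogeneous ℳ := by
  intro i x hx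
  obtain ⟨n, hn, y, hy, rfl⟩ := Submodule.mem_sup.1 hx
  obtain ⟨r, rfl⟩ := Submodule.mem_span_singleton.1 hy
  rw [decompose_add, DirectSum.add_apply, Submodule.coe_add, coe_decompose_smul_of_mem 𝒜 ℳ r hm]
  refine Submodule.add_mem_sup (hN i hn) ?_
  split_ifs
  · exact Submodule.smul_mem _ _ (Submodule.mem_span_singleton_self m)
  · exact zero_mem _

/-- The colon ideal `(N : m)`. -/
abbrev colonElem (N : Submodule R M) (m : M) : Ideal R :=
  N.comap (LinearMap.toSpanSingleton R M m)

lemma mem_colonElem {N : Submodule R M} {m : M} {r : R} : r ∈ colonElem N m ↔ r • m ∈ N := Iff.rfl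

omit [IsScalarTower k R M] in
lemma Submodule.IsHomogeneous.colonElem {N : Submodule R M} (hN : N.IsHomogeneous ℳ)
    {m : M} {s : ℕ} (hm : m ∈ ℳ s) : (colonElem N m).IsHomogeneous 𝒜 := by
  intro i r hr
  have := hN (i + s) (mem_colonElem.1 hr)
  rw [coe_decompose_smul_of_mem 𝒜 ℳ r hm] at this
  rwa [if_pos (Nat.le_add_left s i), Nat.add_sub_cancel] at this

/-- Multiplication by `m`, as an injection `R ⧸ (N : m) → M ⧸ N`. -/
def colonMap (N : Submodule R M) (m : M) : (R ⧸ colonElem N m) →ₗ[R] M ⧸ N :=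
  (colonElem N m).mapQ N (LinearMap.toSpanSingleton R M m) le_rfl

@[simp]
lemma colonMap_mk (N : Submodule R M) (m : M) (r : R) :
    colonMap N m (Submodule.Quotient.mk r) = Submodule.Quotient.mk (r • m) := rfl

lemma colonMap_injective (N : Submodule R M) (m : M) : Function.Injective (colonMap N m) := by
  rw [← LinearMap.ker_eq_bot, colonMap, Submodule.mapQ, Submodule.ker_liftQ, LinearMap.ker_comp,
    Submodule.ker_mkQ]
  exact Submodule.mkQ_map_self _

/-- The projection `M ⧸ N → M ⧸ (N + R m)`. -/
abbrev supFactor (N : Submodule R M) (m : M) : (M ⧸ N) →ₗ[R] M ⧸ (N ⊔ Submodule.span R {m}) :=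
  Submodule.factor le_sup_left

lemma exact_colonMap_supFactor (N : Submodule R M) (m : M) :
    Function.Exact (colonMap N m) (supFactor N m) := by
  intro x
  obtain ⟨x, rfl⟩ := Submodule.Quotient.mk_surjective _ x
  change Submodule.Quotient.mk x = 0 ↔ _
  rw [Submodule.Quotient.mk_eq_zero]
  constructor
  · intro hx
    obtain ⟨n, hn, y, hy, rfl⟩ := Submodule.mem_sup.1 hx
    obtain ⟨r, rfl⟩ := Submodule.mem_span_singleton.1 hy
    refine ⟨Submodule.Quotient.mk r, ?_⟩
    rw [colonMap_mk, eq_comm, Submodule.Quotient.eq]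
    simpa using hn
  · rintro ⟨y, hy⟩
    obtain ⟨r, rfl⟩ := Submodule.Quotient.mk_surjective _ y
    rw [colonMap_mk, eq_comm, Submodule.Quotient.eq] at hy
    rw [← sub_add_cancel x (r • m)]
    exact Submodule.add_mem_sup hy (Submodule.smul_mem _ _ (Submodule.mem_span_singleton_self m))

omit [DirectSum.Decomposition ℳ] in
lemma map_supFactor_gradedImage (N : Submodule R M) (m : M) (i : ℕ) :
    (gradedImage ℳ N i).map ((supFactor N m).restrictScalars k) =
      gradedImage ℳ (N ⊔ Submodule.span R {m}) i := by
  rw [gradedImage, gradedImage, ← Submodule.map_comp]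
  rfl

lemma gradedImage_inf_ker {N : Submodule R M} (hN : N.IsHomogeneous ℳ)
    {m : M} {s : ℕ} (hm : m ∈ ℳ s) (i : ℕ) :
    gradedImage ℳ N i ⊓ LinearMap.ker ((supFactor N m).restrictScalars k) =
      if s ≤ i then
        (gradedImage 𝒜 (colonElem N m) (i - s)).map ((colonMap N m).restrictScalars k)
      else ⊥ := by
  ext x
  constructor
  · rintro ⟨⟨b, hb, rfl⟩, hx⟩
    obtain ⟨y, hy⟩ := (exact_colonMap_supFactor N m _).1 hx
    obtain ⟨r, rfl⟩ := Submodule.Quotient.mk_surjective _ y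
    have h1 : b - r • m ∈ N := (Submodule.Quotient.eq N).1 hy.symm
    have h2 := hN i h1
    rw [decompose_sub, DirectSum.sub_apply, Submodule.coe_sub,
      coe_decompose_smul_of_mem 𝒜 ℳ r hm, decompose_of_mem_same ℳ hb] at h2
    split_ifs at h2 ⊢ with hs
    · refine ⟨_, ⟨_, (decompose 𝒜 r (i - s)).2, rfl⟩, ?_⟩
      exact ((Submodule.Quotient.eq N).2 h2).symm
    · simpa using h2
  · split_ifs with hs
    · rintro ⟨_, ⟨r, hr, rfl⟩, rfl⟩
      refine ⟨⟨r • m, ?_, rfl⟩, (exact_colonMap_supFactor N m _).2 ⟨_, rfl⟩⟩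
      have := SetLike.GradedSMul.smul_mem hr hm
      rwa [vadd_eq_add, Nat.sub_add_cancel hs] at this
    · rintro h
      rw [(Submodule.mem_bot k).1 h]
      exact zero_mem _

/-- The Hilbert function of `M ⧸ N`. -/
noncomputable def hilbertFun (N : Submodule R M) (i : ℕ) : ℕ :=
  finrank k (gradedImage ℳ N i)

lemma finrank_map_of_injective {V W : Type*} [AddCommGroup V] [Module k V]
    [AddCommGroup W] [Module k W] (f : V →ₗ[k] W) (hf : Function.Injective f)
    (p : Submodule k V) : finrank k (p.map f) = finrank k p :=
  (Submodule.equivMapOfInjective f hf p).finrank_eq.symm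

lemma fg_gradedImage_of_sup {N : Submodule R M} (hN : N.IsHomogeneous ℳ)
    {m : M} {s : ℕ} (hm : m ∈ ℳ s) {i : ℕ}
    (h1 : s ≤ i → (gradedImage 𝒜 (colonElem N m) (i - s)).FG)
    (h2 : (gradedImage ℳ (N ⊔ Submodule.span R {m}) i).FG) : (gradedImage ℳ N i).FG := by
  apply Submodule.fg_of_fg_map_of_fg_inf_ker ((supFactor N m).restrictScalars k)
  · rwa [map_supFactor_gradedImage]
  · rw [gradedImage_inf_ker 𝒜 ℳ hN hm]
    split_ifs with hs
    · exact (h1 hs).map _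
    · exact Submodule.fg_bot

lemma hilbertFun_eq_add {N : Submodule R M} (hN : N.IsHomogeneous ℳ)
    {m : M} {s : ℕ} (hm : m ∈ ℳ s) {i : ℕ} (hfg : (gradedImage ℳ N i).FG) :
    hilbertFun ℳ N i = (if s ≤ i then hilbertFun 𝒜 (colonElem N m) (i - s) else 0) +
      hilbertFun ℳ (N ⊔ Submodule.span R {m}) i := by
  have : FiniteDimensional k (gradedImage ℳ N i) := Module.Finite.iff_fg.2 hfg
  let g := (supFactor N m).restrictScalars k
  have h := (g.domRestrict (gradedImage ℳ N i)).finrank_range_add_finrank_ker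
  have hr : LinearMap.range (g.domRestrict (gradedImage ℳ N i)) =
      gradedImage ℳ (N ⊔ Submodule.span R {m}) i := by
    rw [LinearMap.range_domRestrict, map_supFactor_gradedImage]
  have hk : finrank k (LinearMap.ker (g.domRestrict (gradedImage ℳ N i))) =
      finrank k ↥(gradedImage ℳ N i ⊓ LinearMap.ker g) := by
    rw [LinearMap.ker_domRestrict, ← Submodule.map_comap_subtype,
      Submodule.finrank_map_subtype_eq]
  have hK := gradedImage_inf_ker 𝒜 ℳ hN hm i
  rw [hr, hk] at h
  rw [hilbertFun, ← h, add_comm, hilbertFun]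
  congr 1
  split_ifs at hK ⊢ with hs
  · rw [hK]
    exact finrank_map_of_injective ((colonMap N m).restrictScalars k)
      (colonMap_injective N m) _
  · rw [hK]
    exact finrank_bot k _
lemma length_localizedModule_eq_add_of_exact {A B C : Type*} [AddCommGroup A] [Module R A]
    [AddCommGroup B] [Module R B] [AddCommGroup C] [Module R C] (S : Submonoid R)
    (f : A →ₗ[R] B) (g : B →ₗ[R] C) (hf : Function.Injective f) (hg : Function.Surjective g)
    (h : Function.Exact f g) :
    Module.length (Localization S) (LocalizedModule S B) =
      Module.length (Localization S) (LocalizedModule S A) +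
        Module.length (Localization S) (LocalizedModule S C) :=
  Module.length_eq_add_of_exact (LocalizedModule.map S f) (LocalizedModule.map S g)
    (LocalizedModule.map_injective S f hf) (LocalizedModule.map_surjective S g hg)
    (LocalizedModule.map_exact S f g h)

lemma length_localizedModule_congr {A B : Type*} [AddCommGroup A] [Module R A]
    [AddCommGroup B] [Module R B] (S : Submonoid R) (e : A ≃ₗ[R] B) :
    Module.length (Localization S) (LocalizedModule S A) =
      Module.length (Localization S) (LocalizedModule S B) :=
  (LinearEquiv.ofBijective (LocalizedModule.map S e.toLinearMap)
    ⟨LocalizedModule.map_injective S _ e.injective,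
      LocalizedModule.map_surjective S _ e.surjective⟩).length_eq

lemma length_localizedModule_quotient_self (p : Ideal R) [hp : p.IsPrime] :
    Module.length (Localization p.primeCompl) (LocalizedModule p.primeCompl (R ⧸ p)) = 1 := by
  rw [Module.length_eq_one_iff, isSimpleModule_iff_toSpanSingleton_surjective]
  constructor
  · rw [← not_subsingleton_iff_nontrivial, LocalizedModule.subsingleton_iff]
    intro h
    obtain ⟨r, hr, h0⟩ := h (Submodule.Quotient.mk 1)
    rw [← Submodule.Quotient.mk_smul, Submodule.Quotient.mk_eq_zero] at h0
    exact hr (by simpa using h0)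
  · intro x
    induction x using LocalizedModule.induction_on with
    | h m s =>
    obtain ⟨r, rfl⟩ := Submodule.Quotient.mk_surjective _ m
    intro hx
    have hr : r ∈ p.primeCompl := by
      intro hr
      apply hx
      rw [(Submodule.Quotient.mk_eq_zero p).2 hr, LocalizedModule.zero_mk]
    intro y
    induction y using LocalizedModule.induction_on with
    | h n t =>
    obtain ⟨b, rfl⟩ := Submodule.Quotient.mk_surjective _ n
    refine ⟨Localization.mk (b * s) (⟨r, hr⟩ * t), ?_⟩
    rw [LinearMap.toSpanSingleton_apply, LocalizedModule.mk_smul_mk, LocalizedModule.mk_eq]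
    refine ⟨1, ?_⟩
    simp only [Submonoid.smul_def, ← Submodule.Quotient.mk_smul, smul_eq_mul, Submonoid.coe_mul]
    congr 1
    ring

lemma length_localizedModule_quotient_of_not_le {p q : Ideal R} [q.IsPrime] (h : ¬ p ≤ q) :
    Module.length (Localization q.primeCompl) (LocalizedModule q.primeCompl (R ⧸ p)) = 0 := by
  rw [Module.length_eq_zero_iff, LocalizedModule.subsingleton_iff]
  obtain ⟨r, hr, hrq⟩ := Set.not_subset.1 h
  intro m
  obtain ⟨b, rfl⟩ := Submodule.Quotient.mk_surjective _ m
  refine ⟨r, hrq, ?_⟩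
  rw [← Submodule.Quotient.mk_smul, Submodule.Quotient.mk_eq_zero]
  exact p.mul_mem_right b hr

omit [IsScalarTower k R M] in
include 𝒜 in
lemma exists_isPrime_colonElem [IsNoetherianRing R] {N : Submodule R M} (hN : N.IsHomogeneous ℳ)
    (hNtop : N ≠ ⊤) : ∃ s : ℕ, ∃ m ∈ ℳ s, m ∉ N ∧ (colonElem N m).IsPrime := by
  let S : Set (Ideal R) := {J | ∃ s : ℕ, ∃ m ∈ ℳ s, m ∉ N ∧ colonElem N m = J}
  have hS : S.Nonempty := by
    obtain ⟨x, -, hx⟩ := SetLike.exists_of_lt (lt_top_iff_ne_top.2 hNtop)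
    rw [Submodule.IsHomogeneous.mem_iff ℳ hN] at hx
    push Not at hx
    obtain ⟨i, hi⟩ := hx
    exact ⟨_, i, _, (decompose ℳ x i).2, hi, rfl⟩
  obtain ⟨J, ⟨s, m, hm, hmN, rfl⟩, hmax⟩ := set_has_maximal_iff_noetherian.2 ‹_› S hS
  refine ⟨s, m, hm, hmN, ?_⟩
  refine (Submodule.IsHomogeneous.colonElem 𝒜 ℳ hN hm).isPrime_of_homogeneous_mem_or_mem ?_ ?_
  · rw [Ideal.ne_top_iff_one, mem_colonElem, one_smul]
    exact hmN
  · rintro x y - ⟨j, hy⟩ hxy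
    by_contra! ⟨hx, hyN⟩
    have hle : colonElem N m ≤ colonElem N (y • m) := fun r hr ↦ by
      rw [mem_colonElem, smul_comm]
      exact N.smul_mem y hr
    refine hmax _ ⟨j + s, y • m, SetLike.GradedSMul.smul_mem hy hm, hyN, rfl⟩
      (lt_of_le_of_ne hle fun heq ↦ hx ?_)
    rw [heq, mem_colonElem, smul_smul]
    exact hxy

lemma annihilator_le_colonElem (N : Submodule R M) (m : M) :
    Module.annihilator R M ≤ colonElem N m := fun r hr ↦ by
  rw [mem_colonElem, Module.mem_annihilator.1 hr]
  exact N.zero_mem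

open Classical in
/-- A finitely generated graded module has a filtration by homogeneous submodules with
subquotients `(R ⧸ p)(-s)`; it is recorded as the list of the pairs `(p, s)`. -/
theorem exists_primeFiltration [IsNoetherianRing R] [Module.Finite R M]
    (hfin : ∀ i, FiniteDimensional k (ℳ i)) {N : Submodule R M} (hN : N.IsHomogeneous ℳ) :
    ∃ L : List (Ideal R × ℕ),
      (∀ x ∈ L, x.1.IsPrime ∧ x.1.IsHomogeneous 𝒜 ∧ Module.annihilator R M ≤ x.1) ∧
      (∀ i, hilbertFun ℳ N i =
        (L.map fun x ↦ if x.2 ≤ i then hilbertFun 𝒜 x.1 (i - x.2) else 0).sum) ∧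
      ∀ q ∈ (Module.annihilator R M).minimalPrimes, ∀ _ : q.IsPrime,
        Module.length (Localization q.primeCompl) (LocalizedModule q.primeCompl (M ⧸ N)) =
          (L.map Prod.fst).count q := by
  induction N using WellFoundedGT.induction with
  | ind N ih =>
  by_cases hNtop : N = ⊤
  · subst hNtop
    refine ⟨[], by simp, fun i ↦ ?_, fun q _ _ ↦ ?_⟩
    · have : Subsingleton (M ⧸ (⊤ : Submodule R M)) := Submodule.Quotient.subsingleton_iff.2 rfl
      exact finrank_zero_of_subsingleton
    · have : Subsingleton (M ⧸ (⊤ : Submodule R M)) := Submodule.Quotient.subsingleton_iff.2 rfl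
      rw [Module.length_eq_zero_iff.2 (LocalizedModule.subsingleton_iff.2
        fun m ↦ ⟨1, one_mem _, Subsingleton.elim _ _⟩)]
      simp
  · obtain ⟨s, m, hm, hmN, hp⟩ := exists_isPrime_colonElem 𝒜 ℳ hN hNtop
    have hlt : N < N ⊔ Submodule.span R {m} := by
      rw [left_lt_sup, Submodule.span_singleton_le_iff_mem]
      exact hmN
    obtain ⟨L, hL, hH, hlen⟩ := ih _ hlt (hN.sup_span_singleton 𝒜 ℳ hm)
    refine ⟨(colonElem N m, s) :: L, ?_, fun i ↦ ?_, fun q hq hqp ↦ ?_⟩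
    · intro x hx
      rcases List.mem_cons.1 hx with rfl | hx
      · exact ⟨hp, hN.colonElem 𝒜 ℳ hm, annihilator_le_colonElem N m⟩
      · exact hL x hx
    · rw [hilbertFun_eq_add 𝒜 ℳ hN hm ((Module.Finite.iff_fg.1 (hfin i)).map _), hH]
      simp
    · rw [length_localizedModule_eq_add_of_exact q.primeCompl _ _ (colonMap_injective N m)
        (Submodule.factor_surjective _) (exact_colonMap_supFactor N m), hlen q hq hqp,
        List.map_cons, List.count_cons, Nat.cast_add, add_comm]
      congr 1
      by_cases h : colonElem N m = q
      · subst h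
        simp [length_localizedModule_quotient_self]
      · rw [length_localizedModule_quotient_of_not_le fun hle ↦
          h (le_antisymm hle (hq.2 ⟨hp, annihilator_le_colonElem N m⟩ hle))]
        simp [h]

lemma sum_range_shift_le (g : ℕ → ℕ) (s n : ℕ) {t : ℝ} (ht : 0 ≤ t) :
    ∑ i ∈ Finset.range n, ((if s ≤ i then g (i - s) else 0 : ℕ) : ℝ) * t ^ i ≤
      t ^ s * ∑ i ∈ Finset.range n, (g i : ℝ) * t ^ i := by
  have hnonneg : ∀ i, 0 ≤ (g i : ℝ) * t ^ i := fun i ↦ by positivity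
  rcases le_total n s with h | h
  · rw [Finset.sum_eq_zero]
    · exact mul_nonneg (by positivity) (Finset.sum_nonneg fun i _ ↦ hnonneg i)
    · intro i hi
      rw [if_neg (by have := Finset.mem_range.1 hi; omega)]
      simp
  · obtain ⟨m, rfl⟩ := Nat.exists_eq_add_of_le h
    rw [Finset.sum_range_add, Finset.sum_eq_zero, zero_add]
    · calc ∑ i ∈ Finset.range m, ((if s ≤ s + i then g (s + i - s) else 0 : ℕ) : ℝ) * t ^ (s + i)
          = t ^ s * ∑ i ∈ Finset.range m, (g i : ℝ) * t ^ i := by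
            rw [Finset.mul_sum]
            refine Finset.sum_congr rfl fun i _ ↦ ?_
            rw [if_pos (Nat.le_add_right s i), Nat.add_sub_cancel_left, pow_add]
            ring
        _ ≤ _ := by
            refine mul_le_mul_of_nonneg_left ?_ (by positivity)
            exact Finset.sum_le_sum_of_subset_of_nonneg
              (Finset.range_subset_range.2 (by omega)) fun i _ _ ↦ hnonneg i
    · intro i hi
      rw [if_neg (by have := Finset.mem_range.1 hi; omega)]
      simp

/-- The power series `∑ a i * t ^ i` converges on `[0, 1)` and has a pole of order at most `e`
at `1`, stated through its partial sums. -/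
def PoleOrderLE (a : ℕ → ℕ) (e : ℕ) : Prop :=
  ∃ C : ℝ, ∀ t : ℝ, 0 ≤ t → t < 1 → ∀ n : ℕ,
    (1 - t) ^ e * ∑ i ∈ Finset.range n, (a i : ℝ) * t ^ i ≤ C

lemma PoleOrderLE.mono {a : ℕ → ℕ} {e e' : ℕ} (h : PoleOrderLE a e) (hle : e ≤ e') :
    PoleOrderLE a e' := by
  obtain ⟨C, hC⟩ := h
  refine ⟨C, fun t ht ht1 n ↦ le_trans ?_ (hC t ht ht1 n)⟩
  refine mul_le_mul_of_nonneg_right ?_ (Finset.sum_nonneg fun i _ ↦ by positivity)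
  exact pow_le_pow_of_le_one (by linarith) (by linarith) hle

lemma PoleOrderLE.of_forall_pos_eq_zero {a : ℕ → ℕ} (h : ∀ i, 0 < i → a i = 0) (e : ℕ) :
    PoleOrderLE a e := by
  refine PoleOrderLE.mono ⟨a 0, fun t ht ht1 n ↦ ?_⟩ (Nat.zero_le e)
  rw [pow_zero, one_mul]
  calc ∑ i ∈ Finset.range n, (a i : ℝ) * t ^ i
      ≤ ∑ i ∈ Finset.range (n + 1), (a i : ℝ) * t ^ i :=
        Finset.sum_le_sum_of_subset_of_nonneg (Finset.range_subset_range.2 (by omega))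
          fun i _ _ ↦ by positivity
    _ = a 0 := by
        rw [Finset.sum_range_succ', Finset.sum_eq_zero]
        · simp
        · intro i _
          simp [h (i + 1) (by omega)]

lemma PoleOrderLE.of_shift_add {f g h : ℕ → ℕ} {s e : ℕ}
    (hf : ∀ i, f i = (if s ≤ i then g (i - s) else 0) + h i)
    (hg : PoleOrderLE g e) (hh : PoleOrderLE h e) : PoleOrderLE f e := by
  obtain ⟨C, hC⟩ := hg
  obtain ⟨C', hC'⟩ := hh
  refine ⟨C + C', fun t ht ht1 n ↦ le_trans ?_ (add_le_add (hC t ht ht1 n) (hC' t ht ht1 n))⟩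
  rw [← mul_add]
  refine mul_le_mul_of_nonneg_left ?_ (pow_nonneg (by linarith) _)
  simp_rw [hf, Nat.cast_add, add_mul, Finset.sum_add_distrib]
  refine add_le_add_left ((sum_range_shift_le g s n ht).trans ?_) _
  exact mul_le_of_le_one_left (Finset.sum_nonneg fun i _ ↦ by positivity)
    (pow_le_one₀ ht ht1.le)

lemma PoleOrderLE.of_shift_self {f h : ℕ → ℕ} {s e : ℕ} (hs : 0 < s)
    (hf : ∀ i, f i = (if s ≤ i then f (i - s) else 0) + h i)
    (hh : PoleOrderLE h e) : PoleOrderLE f (e + 1) := by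
  obtain ⟨C, hC⟩ := hh
  refine ⟨C, fun t ht ht1 n ↦ le_trans ?_ (hC t ht ht1 n)⟩
  rw [pow_succ, mul_assoc]
  refine mul_le_mul_of_nonneg_left ?_ (pow_nonneg (by linarith) _)
  have h1 := sum_range_shift_le f s n ht
  have h2 : ∑ i ∈ Finset.range n, (f i : ℝ) * t ^ i =
      ∑ i ∈ Finset.range n, ((if s ≤ i then f (i - s) else 0 : ℕ) : ℝ) * t ^ i +
        ∑ i ∈ Finset.range n, (h i : ℝ) * t ^ i := by
    rw [← Finset.sum_add_distrib]
    refine Finset.sum_congr rfl fun i _ ↦ ?_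
    conv_lhs => rw [hf i, Nat.cast_add, add_mul]
  have h3 : t ^ s * ∑ i ∈ Finset.range n, (f i : ℝ) * t ^ i ≤
      t * ∑ i ∈ Finset.range n, (f i : ℝ) * t ^ i :=
    mul_le_mul_of_nonneg_right (pow_le_of_le_one ht ht1.le hs.ne')
      (Finset.sum_nonneg fun i _ ↦ by positivity)
  linarith

lemma PoleOrderLE.summable {a : ℕ → ℕ} {e : ℕ} (h : PoleOrderLE a e) {t : ℝ} (ht : 0 ≤ t)
    (ht1 : t < 1) : Summable fun i ↦ (a i : ℝ) * t ^ i := by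
  obtain ⟨C, hC⟩ := h
  refine summable_of_sum_range_le (c := C / (1 - t) ^ e) (fun i ↦ by positivity) fun n ↦ ?_
  rw [le_div_iff₀ (pow_pos (by linarith) _), mul_comm]
  exact hC t ht ht1 n

lemma PoleOrderLE.tendsto_zero {a : ℕ → ℕ} {e : ℕ} (h : PoleOrderLE a e) :
    Filter.Tendsto (fun t : ℝ ↦ (1 - t) ^ (e + 1) * ∑' i, (a i : ℝ) * t ^ i)
      (nhdsWithin 1 (Set.Ico (0 : ℝ) 1)) (nhds 0) := by
  obtain ⟨C, hC⟩ := id h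
  have hlim : Filter.Tendsto (fun t : ℝ ↦ (1 - t) * C)
      (nhdsWithin 1 (Set.Ico (0 : ℝ) 1)) (nhds 0) := by
    have : Filter.Tendsto (fun t : ℝ ↦ (1 - t) * C) (nhds 1) (nhds ((1 - 1) * C)) :=
      Continuous.tendsto (by fun_prop) 1
    rw [sub_self, zero_mul] at this
    exact this.mono_left nhdsWithin_le_nhds
  refine squeeze_zero' ?_ ?_ hlim
  · filter_upwards [self_mem_nhdsWithin] with t ⟨ht, ht1⟩
    exact mul_nonneg (pow_nonneg (by linarith) _) (tsum_nonneg fun i ↦ by positivity)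
  · filter_upwards [self_mem_nhdsWithin] with t ⟨ht, ht1⟩
    rw [pow_succ', mul_assoc]
    refine mul_le_mul_of_nonneg_left ?_ (by linarith)
    exact le_of_tendsto' ((h.summable ht ht1).hasSum.tendsto_sum_nat.const_mul _) (hC t ht ht1)

lemma hasSum_shift {a : ℕ → ℕ} {t : ℝ} (h : Summable fun i ↦ (a i : ℝ) * t ^ i) (s : ℕ) :
    HasSum (fun i ↦ ((if s ≤ i then a (i - s) else 0 : ℕ) : ℝ) * t ^ i)
      (t ^ s * ∑' i, (a i : ℝ) * t ^ i) := by
  rw [← (add_left_injective s).hasSum_iff]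
  · have hcomp : (fun i ↦ ((if s ≤ i then a (i - s) else 0 : ℕ) : ℝ) * t ^ i) ∘ (· + s) =
        fun i ↦ t ^ s * ((a i : ℝ) * t ^ i) := by
      funext i
      simp only [Function.comp_apply, Nat.le_add_left, if_true, Nat.add_sub_cancel, pow_add]
      ring
    rw [hcomp]
    exact h.hasSum.mul_left (t ^ s)
  · intro i hi
    rw [if_neg fun hs ↦ hi ⟨i - s, Nat.sub_add_cancel hs⟩]
    simp

lemma notMem_ideal_sup_span_singleton_of_pos {I : Ideal R} (hI : I.IsHomogeneous 𝒜) {x : R}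
    {s : ℕ} (hs : 0 < s) (hx : x ∈ 𝒜 s) (hItop : I ≠ ⊤) :
    I ⊔ Ideal.span {x} ≠ ⊤ := by
  rw [Ideal.ne_top_iff_one] at hItop ⊢
  intro h1
  obtain ⟨u, hu, y, hy, h⟩ := Submodule.mem_sup.1 h1
  obtain ⟨r, rfl⟩ := Submodule.mem_span_singleton.1 hy
  have h0 := congrArg (fun z ↦ (decompose 𝒜 z 0 : R)) h
  simp only [decompose_add, DirectSum.add_apply, Submodule.coe_add,
    coe_decompose_smul_of_mem 𝒜 𝒜 r hx, if_neg (show ¬ s ≤ 0 by omega), add_zero,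
    decompose_of_mem_same 𝒜 (SetLike.GradedOne.one_mem (A := 𝒜))] at h0
  exact hItop (h0 ▸ hI 0 hu)

lemma ringKrullDim_quotient_sup_span_singleton_succ_le {p : Ideal R} [p.IsPrime] {x : R}
    (hx : x ∉ p) : ringKrullDim (R ⧸ (p ⊔ Ideal.span {x})) + 1 ≤ ringKrullDim (R ⧸ p) := by
  refine ringKrullDim_succ_le_of_surjective (Ideal.Quotient.factor le_sup_left)
    (Ideal.Quotient.factor_surjective _) (r := Ideal.Quotient.mk p x) ?_ ?_
  · exact mem_nonZeroDivisors_of_ne_zero fun h ↦ hx (Ideal.Quotient.eq_zero_iff_mem.1 h)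
  · rw [Ideal.Quotient.factor_mk, Ideal.Quotient.eq_zero_iff_mem]
    exact Ideal.mem_sup_right (Ideal.mem_span_singleton_self x)

lemma exists_natCast_eq_of_lt {a : WithBot ℕ∞} {d : ℕ} (h0 : 0 ≤ a) (h : a < d) :
    ∃ n : ℕ, a = n ∧ n < d := by
  lift a to ℕ∞ using (by rintro rfl; simp at h0)
  have h' : a < (d : ℕ∞) := by exact_mod_cast h
  lift a to ℕ using h'.ne_top
  exact ⟨a, rfl, by exact_mod_cast h'⟩

lemma exists_natCast_eq_of_add_one_le {a : WithBot ℕ∞} {d : ℕ} (h0 : 0 ≤ a) (h : a + 1 ≤ d) :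
    ∃ n : ℕ, a = n ∧ n < d := by
  lift a to ℕ∞ using (by rintro rfl; simp at h0)
  have h' : a + 1 ≤ (d : ℕ∞) := by exact_mod_cast h
  lift a to ℕ using (by rintro rfl; simp at h')
  exact ⟨a, rfl, by exact_mod_cast h'⟩

lemma ringKrullDim_quotient_anti {I J : Ideal R} (h : I ≤ J) :
    ringKrullDim (R ⧸ J) ≤ ringKrullDim (R ⧸ I) :=
  ringKrullDim_le_of_surjective _ (Ideal.Quotient.factor_surjective h)

/-- The Poincaré series of `R ⧸ I` has a pole of order at most `dim (R ⧸ I)` at `1`. -/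
theorem fg_gradedImage_and_poleOrderLE [IsNoetherianRing R] [FiniteDimensional k (𝒜 0)]
    {I : Ideal R} (hI : I.IsHomogeneous 𝒜) :
    (∀ i, (gradedImage 𝒜 I i).FG) ∧
      ∀ e : ℕ, ringKrullDim (R ⧸ I) ≤ e → PoleOrderLE (hilbertFun 𝒜 I) e := by
  induction I using WellFoundedGT.induction with
  | ind I ih =>
  by_cases hirr : ∀ s, 0 < s → ∀ x ∈ 𝒜 s, x ∈ I
  · have hbot : ∀ i, 0 < i → gradedImage 𝒜 I i = ⊥ := fun i hi ↦ by
      rw [eq_bot_iff]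
      rintro _ ⟨x, hx, rfl⟩
      exact (Submodule.Quotient.mk_eq_zero I).2 (hirr i hi x hx)
    refine ⟨fun i ↦ ?_, fun e _ ↦ PoleOrderLE.of_forall_pos_eq_zero (fun i hi ↦ ?_) e⟩
    · rcases Nat.eq_zero_or_pos i with rfl | hi
      · exact (Module.Finite.iff_fg.1 ‹_›).map _
      · rw [hbot i hi]
        exact Submodule.fg_bot
    · rw [hilbertFun, hbot i hi]
      exact finrank_bot k _
  push Not at hirr
  obtain ⟨s, hs, x, hx, hxI⟩ := hirr
  have hsup : ∀ {j : ℕ} {z : R}, z ∈ 𝒜 j → z ∉ I →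
      (∀ i, (gradedImage 𝒜 (I ⊔ Ideal.span {z}) i).FG) ∧
        ∀ e : ℕ, ringKrullDim (R ⧸ (I ⊔ Ideal.span {z})) ≤ e →
          PoleOrderLE (hilbertFun 𝒜 (I ⊔ Ideal.span {z})) e := fun hz hzI ↦
    ih _ (left_lt_sup.2 fun h ↦ hzI ((Ideal.span_singleton_le_iff_mem I).1 h))
      (Submodule.IsHomogeneous.sup_span_singleton 𝒜 𝒜 hI hz)
  by_cases hp : I.IsPrime
  · obtain ⟨hfg, hpole⟩ := hsup hx hxI
    have hcolon : colonElem I x = I := by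
      ext r
      rw [mem_colonElem, smul_eq_mul]
      exact ⟨fun h ↦ (hp.mem_or_mem h).resolve_right hxI, fun h ↦ I.mul_mem_right x h⟩
    have hfgI : ∀ i, (gradedImage 𝒜 I i).FG := fun i ↦ by
      induction i using Nat.strong_induction_on with
      | _ i ihi =>
      refine fg_gradedImage_of_sup 𝒜 𝒜 hI hx (fun hsi ↦ ?_) (hfg i)
      rw [hcolon]
      exact ihi _ (by omega)
    refine ⟨hfgI, fun e he ↦ ?_⟩
    have hdim := (ringKrullDim_quotient_sup_span_singleton_succ_le hxI).trans he
    have : Nontrivial (R ⧸ (I ⊔ Ideal.span {x})) := Ideal.Quotient.nontrivial_iff.2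
      (notMem_ideal_sup_span_singleton_of_pos 𝒜 hI hs hx hp.ne_top)
    obtain ⟨n, hn, hne⟩ := exists_natCast_eq_of_add_one_le ringKrullDim_nonneg_of_nontrivial hdim
    obtain ⟨e, rfl⟩ := Nat.exists_eq_add_one_of_ne_zero (Nat.ne_zero_of_lt hne)
    refine PoleOrderLE.of_shift_self hs (fun i ↦ ?_) (hpole e ?_)
    · have := hilbertFun_eq_add 𝒜 𝒜 hI hx (hfgI i)
      rwa [hcolon] at this
    · rw [hn]
      exact_mod_cast Nat.lt_succ_iff.1 hne
  · have hItop : I ≠ ⊤ := fun h ↦ hxI (h ▸ Submodule.mem_top)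
    have hex : ∃ y z : R, SetLike.IsHomogeneousElem 𝒜 z ∧ y * z ∈ I ∧ y ∉ I ∧ z ∉ I := by
      by_contra! hcon
      exact hp (hI.isPrime_of_homogeneous_mem_or_mem hItop fun {y z} _ hz hyz ↦
        or_iff_not_imp_left.2 fun hy ↦ hcon y z hz hyz hy)
    obtain ⟨y, z, ⟨j, hz⟩, hyz, hy, hzI⟩ := hex
    have hle : I ≤ colonElem I z := fun r hr ↦ I.mul_mem_right z hr
    obtain ⟨hfg, hpole⟩ := hsup hz hzI
    obtain ⟨hfg', hpole'⟩ := ih (colonElem I z)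
      (lt_of_le_of_ne hle fun h ↦ hy (h ▸ (show y ∈ colonElem I z from hyz)))
      (Submodule.IsHomogeneous.colonElem 𝒜 𝒜 hI hz)
    have hfgI : ∀ i, (gradedImage 𝒜 I i).FG := fun i ↦
      fg_gradedImage_of_sup 𝒜 𝒜 hI hz (fun _ ↦ hfg' _) (hfg i)
    exact ⟨hfgI, fun e he ↦ PoleOrderLE.of_shift_add
      (fun i ↦ hilbertFun_eq_add 𝒜 𝒜 hI hz (hfgI i))
      (hpole' e ((ringKrullDim_quotient_anti hle).trans he))
      (hpole e ((ringKrullDim_quotient_anti le_sup_left).trans he))⟩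

lemma exists_ringKrullDim_quotient_eq_lt {I p : Ideal R} [p.IsPrime] (hIp : I ≤ p) {d : ℕ}
    (hdim : ringKrullDim (R ⧸ I) = d)
    (h : p ∈ I.minimalPrimes → ringKrullDim (R ⧸ p) ≠ ringKrullDim (R ⧸ I)) :
    ∃ n : ℕ, ringKrullDim (R ⧸ p) = n ∧ n < d := by
  have : Nontrivial (R ⧸ p) := Ideal.Quotient.nontrivial_iff.2 (Ideal.IsPrime.ne_top ‹_›)
  have h0 : 0 ≤ ringKrullDim (R ⧸ p) := ringKrullDim_nonneg_of_nontrivial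
  by_cases hp : p ∈ I.minimalPrimes
  · refine exists_natCast_eq_of_lt h0 (lt_of_le_of_ne ?_ ?_)
    · exact hdim ▸ ringKrullDim_quotient_anti hIp
    · exact hdim ▸ h hp
  · obtain ⟨q, hq, hqp⟩ := Ideal.exists_minimalPrimes_le hIp
    have := hq.1.1
    obtain ⟨x, hxp, hxq⟩ := SetLike.exists_of_lt (lt_of_le_of_ne hqp fun h ↦ hp (h ▸ hq))
    refine exists_natCast_eq_of_add_one_le h0 ?_
    calc ringKrullDim (R ⧸ p) + 1 ≤ ringKrullDim (R ⧸ (q ⊔ Ideal.span {x})) + 1 := by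
          gcongr
          exact ringKrullDim_quotient_anti
            (sup_le hqp ((Ideal.span_singleton_le_iff_mem p).2 hxp))
      _ ≤ ringKrullDim (R ⧸ q) := ringKrullDim_quotient_sup_span_singleton_succ_le hxq
      _ ≤ ringKrullDim (R ⧸ I) := ringKrullDim_quotient_anti hq.1.2
      _ = d := hdim

lemma hasSum_list_shift {α : Type*} (a : α → ℕ → ℕ) (L : List (α × ℕ)) {t : ℝ}
    (h : ∀ x ∈ L, Summable fun i ↦ (a x.1 i : ℝ) * t ^ i) :
    HasSum (fun i ↦
      (((L.map fun x ↦ if x.2 ≤ i then a x.1 (i - x.2) else 0).sum : ℕ) : ℝ) * t ^ i)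
      (L.map fun x ↦ t ^ x.2 * ∑' i, (a x.1 i : ℝ) * t ^ i).sum := by
  induction L with
  | nil => simp
  | cons x L ih =>
    have h1 := (hasSum_shift (h x List.mem_cons_self) x.2).add
      (ih fun y hy ↦ h y (List.mem_cons_of_mem x hy))
    simpa only [List.map_cons, List.sum_cons, Nat.cast_add, add_mul] using h1

open Classical in
lemma finsum_mem_count_mul_eq_sum {α : Type*} (L : List α) (D : Set α) (f : α → ℝ) :
    ∑ᶠ p ∈ D, (L.count p : ℝ) * f p = (L.map fun p ↦ if p ∈ D then f p else 0).sum := by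
  rw [Finset.sum_list_map_count, finsum_mem_def,
    finsum_eq_sum_of_support_subset (s := L.toFinset)]
  · refine Finset.sum_congr rfl fun p _ ↦ ?_
    by_cases hp : p ∈ D <;> simp [hp]
  · intro p hp
    by_contra hpL
    rw [List.coe_toFinset, Set.mem_ofPred_eq] at hpL
    apply hp
    simp [List.count_eq_zero.2 hpL]

omit [DirectSum.Decomposition ℳ] in
lemma hilbertFun_bot (i : ℕ) : hilbertFun ℳ (⊥ : Submodule R M) i = finrank k (ℳ i) := by
  have h : Function.Injective (⊥ : Submodule R M).mkQ :=
    LinearMap.ker_eq_bot.1 (Submodule.ker_mkQ _)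
  exact finrank_map_of_injective ((⊥ : Submodule R M).mkQ.restrictScalars k) h _

end GradedHilbert

/-- (Algebraic additivity formula for the degree.)  Let `R` be a
commutative ℕ-graded Noetherian ring with `R₀` a finite-dimensional algebra over a field
`k`, and `M` a nonzero finitely generated graded `R`-module with grading `ℳ`.  Let `D(M)`
be the set of primes `p` minimal over `Ann_R(M)` with `dim(R/p) = dim(R/Ann_R(M))`.
Suppose `dim(R/Ann_R(M)) = d : ℕ`, that `(1-t)^d · P_M(t) → δ` as `t → 1⁻`, and that for
each `p ∈ D(M)` we have `(1-t)^d · P_{R/p}(t) → δ_p` as `t → 1⁻` (the Poincaré series of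
`R/p` being formed from the images of the `𝒜 i` in `R/p`).  Then for each `p ∈ D(M)` the
localization `M_p` has finite length `ℓ(p)` over `R_p`, and `δ = Σ_{p ∈ D(M)} ℓ(p)·δ_p`. -/
theorem stmt10 {k R M : Type*} [Field k] [CommRing R] [Algebra k R] [IsNoetherianRing R]
    (𝒜 : ℕ → Submodule k R) [GradedAlgebra 𝒜] [FiniteDimensional k (𝒜 0)]
    [AddCommGroup M] [Module R M] [Module k M] [IsScalarTower k R M]
    [Module.Finite R M] [Nontrivial M]
    (ℳ : ℕ → Submodule k M) [DirectSum.Decomposition ℳ] [SetLike.GradedSMul 𝒜 ℳ]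
    (hfin : ∀ i, FiniteDimensional k (ℳ i))
    (d : ℕ) (hdim : ringKrullDim (R ⧸ Module.annihilator R M) = d)
    (D : Set (Ideal R))
    (hD : D = {p | p ∈ (Module.annihilator R M).minimalPrimes ∧
      ringKrullDim (R ⧸ p) = ringKrullDim (R ⧸ Module.annihilator R M)})
    (δ : ℝ)
    (hδ : Filter.Tendsto
      (fun t : ℝ => (1 - t) ^ d * ∑' i : ℕ, (Module.finrank k (ℳ i) : ℝ) * t ^ i)
      (nhdsWithin 1 (Set.Ico (0 : ℝ) 1)) (nhds δ))
    (δp : Ideal R → ℝ)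
    (hδp : ∀ p ∈ D, Filter.Tendsto
      (fun t : ℝ => (1 - t) ^ d * ∑' i : ℕ,
        (Module.finrank k
          (Submodule.map (Ideal.Quotient.mkₐ k p).toLinearMap (𝒜 i)) : ℝ) * t ^ i)
      (nhdsWithin 1 (Set.Ico (0 : ℝ) 1)) (nhds (δp p))) :
    ∃ ℓ : Ideal R → ℕ,
      (∀ p ∈ D, p.IsPrime) ∧
      (∀ p ∈ D, ∀ (hp : p.IsPrime),
        IsFiniteLength (Localization (@Ideal.primeCompl R _ p hp))
          (LocalizedModule (@Ideal.primeCompl R _ p hp) M) ∧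
        ∀ s : CompositionSeries (Submodule (Localization (@Ideal.primeCompl R _ p hp))
            (LocalizedModule (@Ideal.primeCompl R _ p hp) M)),
          s.head = ⊥ → s.last = ⊤ → s.length = ℓ p) ∧
      δ = ∑ᶠ p ∈ D, (ℓ p : ℝ) * δp p := by
  classical
  obtain ⟨L, hL, hH, hlen⟩ := exists_primeFiltration 𝒜 ℳ hfin (N := (⊥ : Submodule R M))
    (fun i x hx ↦ by simp [(Submodule.mem_bot R).1 hx])
  have hlenM : ∀ p ∈ D, ∀ hp : p.IsPrime,
      Module.length (Localization p.primeCompl) (LocalizedModule p.primeCompl M) =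
        (L.map Prod.fst).count p := fun p hpD hp ↦ by
    rw [← hlen p (hD ▸ hpD).1 hp]
    exact length_localizedModule_congr _ (Submodule.quotEquivOfEqBot ⊥ rfl).symm
  refine ⟨fun p ↦ (L.map Prod.fst).count p, fun p hp ↦ (hD ▸ hp).1.1.1, fun p hpD hp ↦ ⟨?_, ?_⟩, ?_⟩
  · rw [← Module.length_ne_top_iff, hlenM p hpD hp]
    exact ENat.natCast_ne_top _
  · intro s h0 h1
    have := Module.length_compositionSeries s h0 h1
    rw [hlenM p hpD hp] at this
    exact_mod_cast this
  · have hpole : ∀ x ∈ L, PoleOrderLE (hilbertFun 𝒜 x.1) d := fun x hx ↦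
      (fg_gradedImage_and_poleOrderLE 𝒜 (hL x hx).2.1).2 d
        (hdim ▸ ringKrullDim_quotient_anti (hL x hx).2.2)
    have hterm : ∀ x ∈ L, Filter.Tendsto
        (fun t : ℝ ↦ t ^ x.2 * ((1 - t) ^ d * ∑' i, (hilbertFun 𝒜 x.1 i : ℝ) * t ^ i))
        (nhdsWithin 1 (Set.Ico (0 : ℝ) 1)) (nhds (if x.1 ∈ D then δp x.1 else 0)) := by
      intro x hx
      have hpow : Filter.Tendsto (fun t : ℝ ↦ t ^ x.2) (nhdsWithin 1 (Set.Ico (0 : ℝ) 1))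
          (nhds 1) := by
        have := (continuous_pow x.2).tendsto (1 : ℝ)
        rw [one_pow] at this
        exact this.mono_left nhdsWithin_le_nhds
      rw [← one_mul (if x.1 ∈ D then δp x.1 else 0)]
      refine hpow.mul ?_
      split_ifs with hxD
      · exact hδp x.1 hxD
      · have := (hL x hx).1
        obtain ⟨n, hn, hnd⟩ := exists_ringKrullDim_quotient_eq_lt (hL x hx).2.2 hdim
          fun hmin heq ↦ hxD (hD ▸ ⟨hmin, heq⟩)
        obtain ⟨e, rfl⟩ := Nat.exists_eq_add_one_of_ne_zero (Nat.ne_zero_of_lt hnd)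
        refine ((fg_gradedImage_and_poleOrderLE 𝒜 (hL x hx).2.1).2 e ?_).tendsto_zero
        rw [hn]
        exact_mod_cast Nat.lt_succ_iff.1 hnd
    have hsum := tendsto_list_sum L hterm
    have hNeBot : (nhdsWithin (1 : ℝ) (Set.Ico 0 1)).NeBot := by
      rw [nhdsWithin_Ico_eq_nhdsLT zero_lt_one]
      infer_instance
    have heq : δ = (L.map fun x ↦ if x.1 ∈ D then δp x.1 else 0).sum := by
      refine tendsto_nhds_unique hδ (hsum.congr' ?_)
      filter_upwards [self_mem_nhdsWithin] with t ⟨ht, ht1⟩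
      have h := (hasSum_list_shift (fun p ↦ hilbertFun 𝒜 p) L
        fun x hx ↦ (hpole x hx).summable ht ht1).tsum_eq
      simp_rw [← hH, hilbertFun_bot] at h
      rw [h, ← List.sum_map_mul_left]
      congr 2
      funext x
      ring
    beta_reduce
    rw [heq]
    refine Eq.trans ?_ (finsum_mem_count_mul_eq_sum (L.map Prod.fst) D δp).symm
    rw [List.map_map]
    rfl
end
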